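/- arXiv:2509.25997 — 4 statements merged into one kernel-verified Lean document; each statement's English description precedes it below -/
import Mathlib

section
/- Fix an even integer d ≥ 4. For every ε > 0 there exists q₀ such that for every odd prime power q ≥ q₀ the following holds: for every set P of points in F_q^d and every set S of Q₂^d-spheres all of radius zero, |I(P,S) − q^{−1}|P||S|| ≤ (1+ε)·√(|P|·(q^{d−1}|S| + q^{d/2−1}|S|²)). -/
open Finset

section Defs
variable {F : Type*} [Field F] [Fintype F] [DecidableEq F]

/-- `x₁x₂ + x₃x₄ + ⋯` : the sum of the first `k` products of consecutive pairs
of coordinates. -/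
def pairsForm {d : ℕ} (k : ℕ) (x : Fin d → F) : F :=
  ∑ j ∈ Finset.range k, if h : 2*j+1 < d then x ⟨2*j, by omega⟩ * x ⟨2*j+1, h⟩ else 0

/-- `Q₁^d(x) = x₁x₂ + x₃x₄ + ⋯ + x_{d−1}x_d` (for even `d`). -/
def Q1form {d : ℕ} (x : Fin d → F) : F := pairsForm (d/2) x

/-- `Q₂^d(x) = x₁x₂ + ⋯ + x_{d−3}x_{d−2} + x_{d−1}² − a·x_d²` (for even `d`,
`a` a non-square). -/
def Q2form (a : F) {d : ℕ} (x : Fin d → F) : F :=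
  pairsForm ((d-2)/2) x +
    (if h : 2 ≤ d then x ⟨d-2, by omega⟩ ^ 2 - a * x ⟨d-1, by omega⟩ ^ 2 else 0)

/-- `Q₃^d(x) = x₁x₂ + ⋯ + x_{d−2}x_{d−1} − x_d²` (for odd `d`). -/
def Q3form {d : ℕ} (x : Fin d → F) : F :=
  pairsForm ((d-1)/2) x - (if h : 1 ≤ d then x ⟨d-1, by omega⟩ ^ 2 else 0)

/-- `Q₄^d(x) = x₁x₂ + ⋯ + x_{d−2}x_{d−1} − a·x_d²` (for odd `d`, `a` a non-square). -/
def Q4form (a : F) {d : ℕ} (x : Fin d → F) : F :=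
  pairsForm ((d-1)/2) x - (if h : 1 ≤ d then a * x ⟨d-1, by omega⟩ ^ 2 else 0)

/-- The quadratic form `Q_i^d`. -/
def Qi (a : F) (i : ℕ) {d : ℕ} (x : Fin d → F) : F :=
  if i = 1 then Q1form x else if i = 2 then Q2form a x
  else if i = 3 then Q3form x else Q4form a x

/-- `‖x‖ = x₁² + ⋯ + x_d²`. -/
def normForm {d : ℕ} (x : Fin d → F) : F := ∑ i, x i ^ 2

/-- `I(P,S)`: the number of incidences between a set `P` of points and a set `S`
of `Qf`-spheres, each sphere given as a (center, radius) pair. -/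
def sphIncid {d : ℕ} (Qf : (Fin d → F) → F)
    (P : Finset (Fin d → F)) (S : Finset ((Fin d → F) × F)) : ℕ :=
  ((P ×ˢ S).filter fun z => Qf (z.1 - z.2.1) = z.2.2).card

/-- The set of points of the `Qf`-sphere `s` (given as a (center, radius) pair). -/
def spherePts {d : ℕ} (Qf : (Fin d → F) → F) (s : (Fin d → F) × F) : Finset (Fin d → F) :=
  Finset.univ.filter fun x => Qf (x - s.1) = s.2

end Defs

section Helpers
variable {F : Type*} [Field F]

/-- Barycentric identity for `pairsForm`. -/
lemma pairsForm_barycentric {d : ℕ} (k : ℕ) (w : F) (x u : Fin d → F) :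
    (1 - w) * pairsForm k x + w * pairsForm k (x - u)
      = pairsForm k (x - w • u) + w * (1 - w) * pairsForm k u := by
  simp only [pairsForm, Finset.mul_sum, ← Finset.sum_add_distrib]
  refine Finset.sum_congr rfl fun j _ => ?_
  split_ifs
  · simp only [Pi.sub_apply, Pi.smul_apply, smul_eq_mul]
    ring
  · ring

/-- Barycentric identity for `Q2form`, which completes the square in
`(1 - w) Q(x) + w Q(x - u)`. -/
lemma Q2form_barycentric (a : F) {d : ℕ} (w : F) (x u : Fin d → F) :
    (1 - w) * Q2form a x + w * Q2form a (x - u)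
      = Q2form a (x - w • u) + w * (1 - w) * Q2form a u := by
  have h := pairsForm_barycentric ((d - 2) / 2) w x u
  simp only [Q2form]
  split_ifs
  · simp only [Pi.sub_apply, Pi.smul_apply, smul_eq_mul]
    linear_combination h
  · linear_combination h

lemma Q2form_two (a : F) (x : Fin 2 → F) : Q2form a x = x 0 ^ 2 - a * x 1 ^ 2 := by
  simp [Q2form, pairsForm]

/-- Splitting a hyperbolic plane off `Q2form`. -/
lemma Q2form_cons_cons (a : F) {d : ℕ} (hd : 2 ≤ d) (p r : F) (x : Fin d → F) :
    Q2form a (Fin.cons p (Fin.cons r x : Fin (d + 1) → F) : Fin (d + 2) → F)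
      = p * r + Q2form a x := by
  obtain ⟨e, rfl⟩ := Nat.exists_eq_add_of_le' hd
  have h1 : (e + 2 + 2 - 2) / 2 = e / 2 + 1 := by omega
  have h2 : (e + 2 - 2) / 2 = e / 2 := by omega
  simp only [Q2form, pairsForm, h1, h2, Finset.sum_range_succ']
  have h3 : ∀ j, (if h : 2 * (j + 1) + 1 < e + 2 + 2 then
      (Fin.cons p (Fin.cons r x : Fin (e + 2 + 1) → F) : Fin (e + 2 + 2) → F)
        ⟨2 * (j + 1), by omega⟩ *
      (Fin.cons p (Fin.cons r x : Fin (e + 2 + 1) → F) : Fin (e + 2 + 2) → F)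
        ⟨2 * (j + 1) + 1, h⟩ else 0)
      = if h : 2 * j + 1 < e + 2 then x ⟨2 * j, by omega⟩ * x ⟨2 * j + 1, h⟩ else 0 := by
    intro j
    by_cases h : 2 * j + 1 < e + 2
    · rw [dif_pos h, dif_pos (by omega)]
      rfl
    · rw [dif_neg h, dif_neg (by omega)]
  simp only [h3]
  rw [dif_pos (by omega), dif_pos (by omega), dif_pos (by omega)]
  have h4 : (Fin.cons p (Fin.cons r x : Fin (e + 2 + 1) → F) : Fin (e + 2 + 2) → F)
      ⟨2 * 0, by omega⟩ = p := rfl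
  have h5 : (Fin.cons p (Fin.cons r x : Fin (e + 2 + 1) → F) : Fin (e + 2 + 2) → F)
      ⟨2 * 0 + 1, by omega⟩ = r := rfl
  have h6 : (Fin.cons p (Fin.cons r x : Fin (e + 2 + 1) → F) : Fin (e + 2 + 2) → F)
      ⟨e + 2 + 2 - 2, by omega⟩ = x ⟨e + 2 - 2, by omega⟩ := rfl
  have h7 : (Fin.cons p (Fin.cons r x : Fin (e + 2 + 1) → F) : Fin (e + 2 + 2) → F)
      ⟨e + 2 + 2 - 1, by omega⟩ = x ⟨e + 2 - 1, by omega⟩ := rfl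
  rw [h4, h5, h6, h7]
  ring

end Helpers

lemma sum_fin_succ_fun {α M : Type*} [Fintype α] [AddCommMonoid M] {d : ℕ}
    (f : (Fin (d + 1) → α) → M) :
    ∑ x, f x = ∑ p : α, ∑ x : Fin d → α, f (Fin.cons p x) := by
  rw [← Fintype.sum_prod_type']
  exact (Fintype.sum_equiv (Fin.consEquiv fun _ : Fin (d + 1) => α) _ _ fun _ => rfl).symm

lemma sum_fin_two_fun {α M : Type*} [Fintype α] [AddCommMonoid M] (f : (Fin 2 → α) → M) :
    ∑ x, f x = ∑ p : α, ∑ r : α, f ![p, r] := by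
  simp_rw [sum_fin_succ_fun, Fintype.sum_unique]
  rfl

section CharacterSums
variable {F : Type*} [Field F] [Fintype F] [DecidableEq F]

/-- A quadratic exponential sum in one variable is a quadratic Gauss sum. -/
lemma sum_char_mul_sq (hF : ringChar F ≠ 2) {ψ : AddChar F ℂ} (hψ : ψ.IsPrimitive) {s : F}
    (hs : s ≠ 0) :
    ((quadraticChar F s : ℤ) : ℂ) * ∑ x : F, ψ (s * x ^ 2)
      = gaussSum ((quadraticChar F).ringHomComp (Int.castRingHom ℂ)) ψ := by
  have hfib : ∑ x : F, ψ (s * x ^ 2)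
      = ∑ t : F, (((quadraticChar F t : ℤ) : ℂ) + 1) * ψ (s * t) := by
    rw [← Finset.sum_fiberwise Finset.univ (fun x : F => x ^ 2)]
    refine Finset.sum_congr rfl fun t _ => ?_
    have hcard := quadraticChar_card_sqrts hF t
    rw [Finset.sum_congr rfl (g := fun _ => ψ (s * t))
      (fun x hx => by rw [(Finset.mem_filter.mp hx).2]), Finset.sum_const, nsmul_eq_mul]
    congr 1
    rw [Set.toFinset_ofPred] at hcard
    exact_mod_cast congrArg (Int.cast : ℤ → ℂ) hcard
  have hsum : ∑ t : F, ψ (s * t) = 0 := by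
    have h := AddChar.sum_mulShift s hψ
    rw [if_neg hs] at h
    simpa [mul_comm] using h
  have hshift := gaussSum_mulShift ((quadraticChar F).ringHomComp (Int.castRingHom ℂ)) ψ
    (Units.mk0 s hs)
  rw [← hshift, hfib]
  simp only [add_mul, one_mul, Finset.sum_add_distrib, hsum, add_zero]
  rfl

/-- The exponential sum of the anisotropic plane `x² - a y²`. -/
lemma sum_char_anisotropic (hF : ringChar F ≠ 2) {ψ : AddChar F ℂ} (hψ : ψ.IsPrimitive)
    {a : F} (ha : ¬ IsSquare a) {s : F} (hs : s ≠ 0) :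
    ∑ p : F, ∑ r : F, ψ (s * (p ^ 2 - a * r ^ 2)) = -(Fintype.card F : ℂ) := by
  have ha0 : a ≠ 0 := by
    rintro rfl
    exact ha IsSquare.zero
  have hsa : -1 * s * a ≠ 0 := mul_ne_zero (mul_ne_zero (by simp) hs) ha0
  have h1 := sum_char_mul_sq hF hψ hs
  have h2 := sum_char_mul_sq hF hψ hsa
  have hg := gaussSum_sq
    ((MulChar.ringHomComp_ne_one_iff (Int.castRingHom ℂ).injective_int).mpr
      (quadraticChar_ne_one hF)) ((quadraticChar_isQuadratic F).comp (Int.castRingHom ℂ)) hψ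
  have hsplit : ∑ p : F, ∑ r : F, ψ (s * (p ^ 2 - a * r ^ 2))
      = (∑ p : F, ψ (s * p ^ 2)) * ∑ r : F, ψ (-1 * s * a * r ^ 2) := by
    rw [Finset.sum_mul_sum]
    refine Finset.sum_congr rfl fun p _ => Finset.sum_congr rfl fun r _ => ?_
    rw [← AddChar.map_add_eq_mul]
    congr 1
    ring
  have hχs : ((quadraticChar F s : ℤ) : ℂ) ^ 2 = 1 := by
    exact_mod_cast quadraticChar_sq_one hs
  have hχn : ((quadraticChar F (-1) : ℤ) : ℂ) ^ 2 = 1 := by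
    rw [← Int.cast_pow, quadraticChar_sq_one (neg_ne_zero.mpr one_ne_zero), Int.cast_one]
  have hχa : ((quadraticChar F a : ℤ) : ℂ) = -1 := by
    exact_mod_cast congrArg (Int.cast : ℤ → ℂ) (quadraticChar_neg_one_iff_not_isSquare.mpr ha)
  rw [hsplit]
  rw [map_mul, map_mul] at h2
  push_cast at h2
  rw [hχa] at h2
  rw [MulChar.ringHomComp_apply, eq_intCast, pow_two] at hg
  nth_rewrite 1 [← h1] at hg
  rw [← h2] at hg
  set T := ∑ p : F, ψ (s * p ^ 2)
  set U := ∑ r : F, ψ (-1 * s * a * r ^ 2)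
  set c := ((quadraticChar F s : ℤ) : ℂ)
  set n := ((quadraticChar F (-1) : ℤ) : ℂ)
  linear_combination (-n) * hg - T * U * hχs * n ^ 2 - (T * U + (Fintype.card F : ℂ)) * hχn

/-- The exponential sum of `Q₂` in dimension `2k + 2`. -/
lemma sum_char_Q2form (hF : ringChar F ≠ 2) {ψ : AddChar F ℂ} (hψ : ψ.IsPrimitive)
    {a : F} (ha : ¬ IsSquare a) {s : F} (hs : s ≠ 0) (k : ℕ) :
    ∑ x : Fin (2 * k + 2) → F, ψ (s * Q2form a x) = -(Fintype.card F : ℂ) ^ (k + 1) := by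
  induction k with
  | zero =>
    have h := sum_fin_two_fun fun x : Fin 2 → F => ψ (s * Q2form a x)
    simp only [Q2form_two, Matrix.cons_val_zero, Matrix.cons_val_one] at h
    simpa [Q2form_two, sum_char_anisotropic hF hψ ha hs] using h
  | succ k ih =>
    have h := sum_fin_succ_fun fun x : Fin (2 * k + 2 + 2) → F => ψ (s * Q2form a x)
    simp_rw [sum_fin_succ_fun (d := 2 * k + 2),
      Q2form_cons_cons a (Nat.le_add_left 2 (2 * k)), mul_add, AddChar.map_add_eq_mul,
      ← Finset.mul_sum, ih, ← Finset.sum_mul] at h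
    refine h.trans ?_
    have hin : ∀ p : F, ∑ r : F, ψ (s * (p * r)) = if p = 0 then (Fintype.card F : ℂ) else 0 := by
      intro p
      have h := AddChar.sum_mulShift (s * p) hψ
      simp only [mul_eq_zero, hs, false_or, Nat.cast_ite, Nat.cast_zero] at h
      exact (Finset.sum_congr rfl fun r _ => congrArg ψ (by ring)).trans h
    simp only [hin, Finset.sum_ite_eq', Finset.mem_univ, if_true]
    ring

/-- Nondegeneracy of `Q₂`, as the vanishing of an exponential sum. -/
lemma sum_char_Q2form_sub (hF : ringChar F ≠ 2) {ψ : AddChar F ℂ} (hψ : ψ.IsPrimitive)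
    {a : F} (ha : a ≠ 0) {t : F} (ht : t ≠ 0) (k : ℕ) {u : Fin (2 * k + 2) → F} (hu : u ≠ 0) :
    ∑ x : Fin (2 * k + 2) → F, ψ (t * (Q2form a (x - u) - Q2form a x)) = 0 := by
  have hlin : ∀ b : F, b ≠ 0 → ∑ r : F, ψ (r * b) = 0 := by
    intro b hb
    rw [AddChar.sum_mulShift b hψ, if_neg hb, Nat.cast_zero]
  induction k with
  | zero =>
    have h := sum_fin_two_fun fun x : Fin 2 → F => ψ (t * (Q2form a (x - u) - Q2form a x))
    refine h.trans ?_
    have h2 : (2 : F) ≠ 0 := Ring.two_ne_zero hF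
    have hsplit : ∀ p r : F, ψ (t * (Q2form a (![p, r] - u) - Q2form a ![p, r]))
        = ψ (t * (u 0 ^ 2 - a * u 1 ^ 2)) *
          (ψ (p * (2 * t * -u 0)) * ψ (r * (2 * t * a * u 1))) := by
      intro p r
      rw [← AddChar.map_add_eq_mul, ← AddChar.map_add_eq_mul]
      simp only [Q2form_two, Pi.sub_apply, Matrix.cons_val_zero, Matrix.cons_val_one]
      congr 1
      ring
    simp only [hsplit, ← Finset.mul_sum, ← Finset.sum_mul]
    by_cases h0 : u 0 = 0
    · have h1 : u 1 ≠ 0 := fun h1 => hu (by ext i; fin_cases i <;> assumption)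
      rw [hlin (2 * t * a * u 1) (by simp [*])]
      simp
    · rw [hlin (2 * t * -u 0) (by simp [*])]
      simp
  | succ k ih =>
    obtain ⟨b, c, v, rfl⟩ : ∃ (b c : F) (v : Fin (2 * k + 2) → F),
        u = (Fin.cons b (Fin.cons c v : Fin (2 * k + 2 + 1) → F) : Fin (2 * k + 2 + 2) → F) :=
      ⟨u 0, Fin.tail u 0, Fin.tail (Fin.tail u), by rw [Fin.cons_self_tail, Fin.cons_self_tail]⟩
    have h := sum_fin_succ_fun fun x : Fin (2 * k + 2 + 2) → F => ψ (t * (Q2form a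
      (x - (Fin.cons b (Fin.cons c v : Fin (2 * k + 2 + 1) → F) : Fin (2 * k + 2 + 2) → F))
        - Q2form a x))
    refine h.trans ?_
    simp_rw [sum_fin_succ_fun (d := 2 * k + 2)]
    have hsub : ∀ (p r : F) (x : Fin (2 * k + 2) → F),
        (Fin.cons p (Fin.cons r x : Fin (2 * k + 2 + 1) → F) : Fin (2 * k + 2 + 2) → F)
          - (Fin.cons b (Fin.cons c v : Fin (2 * k + 2 + 1) → F) : Fin (2 * k + 2 + 2) → F)
        = (Fin.cons (p - b) (Fin.cons (r - c) (x - v) : Fin (2 * k + 2 + 1) → F)) := by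
      intro p r x
      ext i
      refine Fin.cases rfl (fun i => Fin.cases rfl (fun i => rfl) i) i
    have hsplit : ∀ (p r : F) (x : Fin (2 * k + 2) → F),
        ψ (t * ((p - b) * (r - c) + Q2form a (x - v) - (p * r + Q2form a x)))
        = ψ (t * (b * c)) * (ψ (p * (t * -c)) * ψ (r * (t * -b)))
          * ψ (t * (Q2form a (x - v) - Q2form a x)) := by
      intro p r x
      simp only [← AddChar.map_add_eq_mul]
      congr 1
      ring
    simp only [hsub, Q2form_cons_cons a (Nat.le_add_left 2 (2 * k)), hsplit, ← Finset.mul_sum,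
      ← Finset.sum_mul]
    by_cases hv : v = 0
    · by_cases hb : b = 0
      · have hc : c ≠ 0 := by
          rintro rfl
          subst hb hv
          refine hu ?_
          ext i
          refine Fin.cases rfl (fun i => Fin.cases rfl (fun i => rfl) i) i
        rw [hlin (t * -c) (by simp [*])]
        simp
      · rw [hlin (t * -b) (by simp [*])]
        simp
    · rw [ih hv, mul_zero]

/-- The number of zeros of `Q₂` in dimension `2k + 2`. -/
lemma card_Q2form_eq_zero (hF : ringChar F ≠ 2) {a : F} (ha : ¬ IsSquare a) (k : ℕ) :
    (Fintype.card F : ℝ) * (univ.filter fun x : Fin (2 * k + 2) → F => Q2form a x = 0).card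
      = (Fintype.card F : ℝ) ^ (2 * k + 2)
        - (Fintype.card F : ℝ) ^ (k + 1) * ((Fintype.card F : ℝ) - 1) := by
  have hψ := AddChar.FiniteField.primitiveChar_to_Complex_isPrimitive F
  set ψ := AddChar.FiniteField.primitiveChar_to_Complex F
  have hq : 1 ≤ Fintype.card F := Fintype.card_pos
  have key : (Fintype.card F : ℂ)
        * (univ.filter fun x : Fin (2 * k + 2) → F => Q2form a x = 0).card
      = ∑ s : F, ∑ x : Fin (2 * k + 2) → F, ψ (s * Q2form a x) := by
    rw [Finset.sum_comm]
    simp only [AddChar.sum_mulShift _ hψ, Finset.card_filter]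
    push_cast
    rw [Finset.mul_sum]
    exact Finset.sum_congr rfl fun x _ => by split_ifs <;> simp
  rw [← Finset.add_sum_erase _ _ (Finset.mem_univ (0 : F)),
    Finset.sum_congr rfl (fun s hs => sum_char_Q2form hF hψ ha (Finset.ne_of_mem_erase hs) k)]
    at key
  simp only [zero_mul, AddChar.map_zero_eq_one, Finset.sum_const, Finset.card_univ,
    Fintype.card_fun, Fintype.card_fin, nsmul_eq_mul, mul_one, Finset.card_erase_of_mem,
    Finset.mem_univ, Nat.cast_pow, Nat.cast_sub hq, Nat.cast_one] at key
  have h : (Fintype.card F : ℂ)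
        * (univ.filter fun x : Fin (2 * k + 2) → F => Q2form a x = 0).card
      = (Fintype.card F : ℂ) ^ (2 * k + 2)
        - (Fintype.card F : ℂ) ^ (k + 1) * ((Fintype.card F : ℂ) - 1) := by
    rw [key]
    ring
  exact_mod_cast h

/-- The number of common points of two zero-radius `Q₂`-spheres with distinct centers. -/
lemma card_Q2form_inter (hF : ringChar F ≠ 2) {a : F} (ha : ¬ IsSquare a) (k : ℕ)
    {u : Fin (2 * k + 2) → F} (hu : u ≠ 0) :
    (Fintype.card F : ℝ) ^ 2 *
        (univ.filter fun x : Fin (2 * k + 2) → F => Q2form a x = 0 ∧ Q2form a (x - u) = 0).card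
      = (Fintype.card F : ℝ) ^ (2 * k + 2) - (Fintype.card F : ℝ) ^ (k + 1) *
        ((Fintype.card F : ℝ) * (univ.filter fun w : F => w * (1 - w) * Q2form a u = 0).card
          - Fintype.card F) := by
  have hψ := AddChar.FiniteField.primitiveChar_to_Complex_isPrimitive F
  set ψ := AddChar.FiniteField.primitiveChar_to_Complex F
  have ha0 : a ≠ 0 := by
    rintro rfl
    exact ha IsSquare.zero
  have key : (Fintype.card F : ℂ) ^ 2 *
        (univ.filter fun x : Fin (2 * k + 2) → F => Q2form a x = 0 ∧ Q2form a (x - u) = 0).card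
      = ∑ r : F, ∑ t : F, ∑ x : Fin (2 * k + 2) → F,
          ψ ((r - t) * Q2form a x + t * Q2form a (x - u)) := by
    have hshift : ∀ x : Fin (2 * k + 2) → F,
        ∑ t : F, ∑ r : F, ψ ((r - t) * Q2form a x + t * Q2form a (x - u))
        = (∑ t : F, ψ (t * Q2form a (x - u))) * ∑ s : F, ψ (s * Q2form a x) := by
      intro x
      rw [Finset.sum_mul_sum]
      refine Finset.sum_congr rfl fun t _ => ?_
      rw [← Equiv.sum_comp (Equiv.addRight t)]
      refine Finset.sum_congr rfl fun r _ => ?_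
      rw [← AddChar.map_add_eq_mul, Equiv.coe_addRight, add_sub_cancel_right, add_comm]
    rw [Finset.sum_comm]
    simp_rw [Finset.sum_comm (t := (univ : Finset (Fin (2 * k + 2) → F)))]
    simp only [hshift, AddChar.sum_mulShift _ hψ, Finset.card_filter]
    push_cast
    rw [Finset.mul_sum]
    refine Finset.sum_congr rfl fun x _ => ?_
    by_cases h1 : Q2form a x = 0 <;> by_cases h2 : Q2form a (x - u) = 0 <;> simp [h1, h2, pow_two]
  have hzero : ∑ t : F, ∑ x : Fin (2 * k + 2) → F,
      ψ ((0 - t) * Q2form a x + t * Q2form a (x - u)) = (Fintype.card F : ℂ) ^ (2 * k + 2) := by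
    rw [Finset.sum_eq_single (0 : F)]
    · simp
    · intro t _ ht
      rw [← sum_char_Q2form_sub hF hψ ha0 ht k hu]
      exact Finset.sum_congr rfl fun x _ => congrArg ψ (by ring)
    · simp
  have hne : ∀ r : F, r ≠ 0 → ∑ t : F, ∑ x : Fin (2 * k + 2) → F,
      ψ ((r - t) * Q2form a x + t * Q2form a (x - u))
      = -(Fintype.card F : ℂ) ^ (k + 1) * ∑ w : F, ψ (r * (w * (1 - w) * Q2form a u)) := by
    intro r hr
    rw [← Equiv.sum_comp (Equiv.mulLeft₀ r hr), Finset.mul_sum]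
    refine Finset.sum_congr rfl fun w _ => ?_
    rw [← sum_char_Q2form hF hψ ha hr k, Finset.sum_mul,
      ← Equiv.sum_comp (Equiv.subRight (w • u)) fun y => ψ (r * Q2form a y) * _]
    refine Finset.sum_congr rfl fun x _ => ?_
    rw [← AddChar.map_add_eq_mul]
    congr 1
    simp only [Equiv.subRight_apply, Equiv.mulLeft₀_apply]
    linear_combination r * Q2form_barycentric a w x u
  have hJ : ∑ r : F, ∑ w : F, ψ (r * (w * (1 - w) * Q2form a u))
      = (Fintype.card F : ℂ) * (univ.filter fun w : F => w * (1 - w) * Q2form a u = 0).card := by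
    rw [Finset.sum_comm]
    simp only [AddChar.sum_mulShift _ hψ, Finset.card_filter]
    push_cast
    rw [Finset.mul_sum]
    exact Finset.sum_congr rfl fun x _ => by split_ifs <;> simp
  rw [← Finset.add_sum_erase _ _ (Finset.mem_univ (0 : F)), hzero,
    Finset.sum_congr rfl (fun r hr => hne r (Finset.ne_of_mem_erase hr)), ← Finset.mul_sum] at key
  rw [← Finset.add_sum_erase _ _ (Finset.mem_univ (0 : F))] at hJ
  simp only [zero_mul, AddChar.map_zero_eq_one, Finset.sum_const, Finset.card_univ,
    nsmul_eq_mul, mul_one] at hJ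
  have h : (Fintype.card F : ℂ) ^ 2 *
        (univ.filter fun x : Fin (2 * k + 2) → F => Q2form a x = 0 ∧ Q2form a (x - u) = 0).card
      = (Fintype.card F : ℂ) ^ (2 * k + 2) - (Fintype.card F : ℂ) ^ (k + 1) *
        ((Fintype.card F : ℂ) * (univ.filter fun w : F => w * (1 - w) * Q2form a u = 0).card
          - Fintype.card F) := by
    rw [key, ← hJ]
    ring
  exact_mod_cast h

lemma card_Q2form_inter_le (hF : ringChar F ≠ 2) {a : F} (ha : ¬ IsSquare a) (k : ℕ)
    {u : Fin (2 * k + 2) → F} (hu : u ≠ 0) :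
    (Fintype.card F : ℝ) ^ 2 *
        (univ.filter fun x : Fin (2 * k + 2) → F => Q2form a x = 0 ∧ Q2form a (x - u) = 0).card
      ≤ (Fintype.card F : ℝ) ^ (2 * k + 2) - (Fintype.card F : ℝ) ^ (k + 2) := by
  have hW : (2 : ℝ) ≤ (univ.filter fun w : F => w * (1 - w) * Q2form a u = 0).card := by
    have h : ({0, 1} : Finset F) ⊆ univ.filter fun w : F => w * (1 - w) * Q2form a u = 0 := by
      intro w hw
      rcases Finset.mem_insert.mp hw with rfl | hw
      · simp
      · simp [Finset.mem_singleton.mp hw]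
    have h2 := Finset.card_le_card h
    rw [Finset.card_pair zero_ne_one] at h2
    exact_mod_cast h2
  rw [card_Q2form_inter hF ha k hu]
  have hpos : (0 : ℝ) ≤ (Fintype.card F : ℝ) ^ (k + 2) := by positivity
  nlinarith [mul_le_mul_of_nonneg_left hW hpos, pow_succ (Fintype.card F : ℝ) (k + 1)]

/-- Correlation of the balanced indicator functions of two zero-radius `Q₂`-spheres. -/
lemma sum_balanced_mul_le (hF : ringChar F ≠ 2) {a : F} (ha : ¬ IsSquare a) (k : ℕ)
    (c c' : Fin (2 * k + 2) → F) :
    ∑ x : Fin (2 * k + 2) → F,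
        ((if Q2form a (x - c) = 0 then 1 else 0) - (Fintype.card F : ℝ)⁻¹) *
        ((if Q2form a (x - c') = 0 then 1 else 0) - (Fintype.card F : ℝ)⁻¹)
      ≤ (if c = c' then (Fintype.card F : ℝ) ^ (2 * k + 1) else 0)
        + (Fintype.card F : ℝ) ^ k := by
  have hZ := card_Q2form_eq_zero hF ha k
  have hM : c ≠ c' → _ := fun h => card_Q2form_inter_le hF ha k (u := c' - c)
    (sub_ne_zero.mpr (Ne.symm h))
  have hq : (2 : ℝ) ≤ Fintype.card F := by exact_mod_cast Fintype.one_lt_card (α := F)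
  have hsum : ∀ c : Fin (2 * k + 2) → F,
      ∑ x : Fin (2 * k + 2) → F, (if Q2form a (x - c) = 0 then (1 : ℝ) else 0)
      = (univ.filter fun x : Fin (2 * k + 2) → F => Q2form a x = 0).card := by
    intro c
    rw [Finset.card_filter, ← Equiv.sum_comp (Equiv.addRight c)]
    push_cast
    simp only [Equiv.coe_addRight, add_sub_cancel_right]
  have hinter : ∑ x : Fin (2 * k + 2) → F, (if Q2form a (x - c) = 0 then (1 : ℝ) else 0)
        * (if Q2form a (x - c') = 0 then 1 else 0)
      = (univ.filter fun x : Fin (2 * k + 2) → F =>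
          Q2form a x = 0 ∧ Q2form a (x - (c' - c)) = 0).card := by
    rw [Finset.card_filter, ← Equiv.sum_comp (Equiv.addRight c)]
    push_cast
    refine Finset.sum_congr rfl fun x _ => ?_
    rw [Equiv.coe_addRight, add_sub_cancel_right, ← sub_sub_eq_add_sub, mul_ite, mul_one,
      mul_zero, ← ite_and]
    exact if_congr and_comm rfl rfl
  have hexp : ∀ x : Fin (2 * k + 2) → F,
      ((if Q2form a (x - c) = 0 then 1 else 0) - (Fintype.card F : ℝ)⁻¹) *
        ((if Q2form a (x - c') = 0 then 1 else 0) - (Fintype.card F : ℝ)⁻¹)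
      = (if Q2form a (x - c) = 0 then (1 : ℝ) else 0) * (if Q2form a (x - c') = 0 then 1 else 0)
        - (Fintype.card F : ℝ)⁻¹ * (if Q2form a (x - c) = 0 then (1 : ℝ) else 0)
        - (Fintype.card F : ℝ)⁻¹ * (if Q2form a (x - c') = 0 then (1 : ℝ) else 0)
        + (Fintype.card F : ℝ)⁻¹ ^ 2 := fun x => by ring
  simp only [hexp, Finset.sum_add_distrib, Finset.sum_sub_distrib, ← Finset.mul_sum, hsum, hinter,
    Finset.sum_const, Finset.card_univ, Fintype.card_fun, Fintype.card_fin, nsmul_eq_mul]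
  push_cast
  set q : ℝ := (Fintype.card F : ℝ)
  have hq0 : 0 < q := by linarith
  have hqk : 0 < q ^ k := by positivity
  refine le_of_mul_le_mul_left ?_ (pow_pos hq0 2)
  set Z : ℝ := ((univ.filter fun x : Fin (2 * k + 2) → F => Q2form a x = 0).card : ℝ) with hZdef
  set M : ℝ := ((univ.filter fun x : Fin (2 * k + 2) → F =>
    Q2form a x = 0 ∧ Q2form a (x - (c' - c)) = 0).card : ℝ) with hMdef
  have hexpand : q ^ 2 * (M - q⁻¹ * Z - q⁻¹ * Z + q ^ (2 * k + 2) * q⁻¹ ^ 2)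
      = q ^ 2 * M - 2 * (q * Z) + q ^ (2 * k + 2) := by
    field_simp
    ring
  rw [hexpand, hZ]
  by_cases h : c = c'
  · have hMZ : M = Z := by
      rw [hMdef, hZdef, h]
      simp
    rw [if_pos h, hMZ, pow_two, mul_assoc, hZ]
    have h1 : 0 < q ^ (2 * k + 1) := by positivity
    have h3 : q ^ (2 * k + 2) = q * q ^ (2 * k + 1) := by ring
    have h4 : q ^ (k + 1) = q * q ^ k := by ring
    rw [h3, h4]
    nlinarith [mul_pos hq0 h1, mul_pos hq0 hqk, mul_pos hq0 (mul_pos hq0 hqk),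
      mul_nonneg (mul_pos hq0 (mul_pos hq0 hqk)).le (sub_nonneg.mpr hq)]
  · rw [if_neg h]
    have h2 : 0 < q ^ (k + 1) := by positivity
    have h3 : q ^ (k + 2) = q * q ^ (k + 1) := by ring
    have h4 : q ^ 2 * (0 + q ^ k) = q * q ^ (k + 1) := by ring
    rw [h4]
    have := hM h
    rw [h3] at this
    linarith

end CharacterSums

lemma abs_sum_sum_le_sqrt {α β : Type*} [Fintype α] (P : Finset α) (S : Finset β)
    (e : α → β → ℝ) (B : ℝ) (hB : ∑ s ∈ S, ∑ s' ∈ S, ∑ x, e x s * e x s' ≤ B) :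
    |∑ x ∈ P, ∑ s ∈ S, e x s| ≤ Real.sqrt (P.card * B) := by
  refine Real.abs_le_sqrt ?_
  refine sq_sum_le_card_mul_sum_sq.trans ?_
  refine mul_le_mul_of_nonneg_left ?_ (Nat.cast_nonneg _)
  calc ∑ x ∈ P, (∑ s ∈ S, e x s) ^ 2 ≤ ∑ x, (∑ s ∈ S, e x s) ^ 2 :=
        Finset.sum_le_sum_of_subset_of_nonneg (Finset.subset_univ P) fun _ _ _ => sq_nonneg _
    _ = ∑ s ∈ S, ∑ s' ∈ S, ∑ x, e x s * e x s' := by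
        simp_rw [pow_two, Finset.sum_mul_sum]
        rw [Finset.sum_comm]
        exact Finset.sum_congr rfl fun s _ => Finset.sum_comm
    _ ≤ B := hB

/-- Incidence bound for zero-radius `Q₂^d`-spheres (even `d`), for all
sufficiently large odd prime powers `q`. -/
theorem stmt4 (d : ℕ) (hd : 4 ≤ d) (hdeven : Even d) :
    ∀ ε : ℝ, 0 < ε → ∃ q₀ : ℕ,
      ∀ (F : Type) [Field F] [Fintype F] [DecidableEq F],
        Odd (Fintype.card F) → q₀ ≤ Fintype.card F →
        ∀ (a : F), ¬ IsSquare a →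
        ∀ (P : Finset (Fin d → F)) (S : Finset ((Fin d → F) × F)),
          (∀ s ∈ S, s.2 = 0) →
          |(sphIncid (Q2form a) P S : ℝ) - (Fintype.card F : ℝ)⁻¹ * P.card * S.card|
            ≤ (1 + ε) * Real.sqrt ((P.card : ℝ) *
                ((Fintype.card F : ℝ) ^ (d-1) * S.card
                  + (Fintype.card F : ℝ) ^ (d/2-1) * (S.card : ℝ) ^ 2)) := by
  intro ε hε
  refine ⟨0, fun F _ _ _ hodd _ a ha P S hS => ?_⟩
  obtain ⟨k, rfl⟩ : ∃ k, d = 2 * k + 2 := by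
    obtain ⟨m, rfl⟩ := hdeven
    exact ⟨m - 1, by omega⟩
  have hF : ringChar F ≠ 2 := fun h =>
    Nat.not_even_iff_odd.mpr hodd (Nat.even_iff.mpr (FiniteField.even_card_of_char_two h))
  have hk1 : 2 * k + 2 - 1 = 2 * k + 1 := by omega
  have hk2 : (2 * k + 2) / 2 - 1 = k := by omega
  rw [hk1, hk2]
  have hI : (sphIncid (Q2form a) P S : ℝ) - (Fintype.card F : ℝ)⁻¹ * P.card * S.card
      = ∑ x ∈ P, ∑ s ∈ S,
        ((if Q2form a (x - s.1) = 0 then 1 else 0) - (Fintype.card F : ℝ)⁻¹) := by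
    have hcount : (sphIncid (Q2form a) P S : ℝ)
        = ∑ x ∈ P, ∑ s ∈ S, if Q2form a (x - s.1) = 0 then (1 : ℝ) else 0 := by
      rw [sphIncid, Finset.card_filter, Finset.sum_product]
      push_cast
      exact Finset.sum_congr rfl fun x _ => Finset.sum_congr rfl fun s hs => by rw [hS s hs]
    simp only [hcount, Finset.sum_sub_distrib, Finset.sum_const, nsmul_eq_mul]
    ring
  rw [hI]
  refine (abs_sum_sum_le_sqrt P S _ _ ?_).trans
    (le_mul_of_one_le_left (Real.sqrt_nonneg _) (by linarith))
  have hdiag : ∀ s ∈ S, ∑ s' ∈ S,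
      ((if s.1 = s'.1 then (Fintype.card F : ℝ) ^ (2 * k + 1) else 0) + (Fintype.card F : ℝ) ^ k)
      = (Fintype.card F : ℝ) ^ (2 * k + 1) + (Fintype.card F : ℝ) ^ k * S.card := by
    intro s hs
    rw [Finset.sum_add_distrib, Finset.sum_const, nsmul_eq_mul, Finset.sum_eq_single s]
    · rw [if_pos rfl]
      ring
    · intro s' hs' hne
      exact if_neg fun h => hne (Prod.ext h.symm ((hS s' hs').trans (hS s hs).symm))
    · exact fun h => absurd hs h
  calc _ ≤ ∑ s ∈ S, ∑ s' ∈ S, ((if s.1 = s'.1 then (Fintype.card F : ℝ) ^ (2 * k + 1) else 0)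
          + (Fintype.card F : ℝ) ^ k) :=
        Finset.sum_le_sum fun s _ => Finset.sum_le_sum fun s' _ =>
          sum_balanced_mul_le hF ha k s.1 s'.1
    _ = _ := by
        rw [Finset.sum_congr rfl hdiag, Finset.sum_const, nsmul_eq_mul]
        ring
end

section
/- Fix an even integer d ≥ 4. For every ε > 0 there exists q₀ such that for every odd prime power q ≥ q₀ the following holds: for every set P of points in F_q^d and every set S of Q₁^d-spheres all of radius zero, |I(P,S) − q^{−1}|P||S|| ≤ (1+ε)·√(|P|·(q^{d−1}|S| + q^{d/2}|S|²)). -/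
open Finset

section SecondMoment
variable {X : Type*} [AddCommGroup X] [Fintype X] [DecidableEq X]

/-- The second moment of the number of translates `t + Z`, `t ∈ T`, through a point, centred at
`c * #T`, when distinct translates of `Z` meet in at most `M` points. -/
lemma sum_sq_card_translates_le (Z T : Finset X) (c M : ℝ)
    (hM : ∀ v : X, v ≠ 0 → ((univ.filter fun x => x ∈ Z ∧ x - v ∈ Z).card : ℝ) ≤ M) :
    ∑ x : X, (((T.filter fun t => x - t ∈ Z).card : ℝ) - c * T.card) ^ 2 ≤
      T.card * Z.card + ((T.card : ℝ) ^ 2 - T.card) * M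
        - 2 * c * (T.card : ℝ) ^ 2 * Z.card + c ^ 2 * (T.card : ℝ) ^ 2 * Fintype.card X := by
  have first_moment : ∑ x : X, ((T.filter fun t => x - t ∈ Z).card : ℝ) = T.card * Z.card := by
    simp only [Finset.card_filter, Nat.cast_sum]
    rw [Finset.sum_comm]
    have translate : ∀ t ∈ T, ∑ x : X, (((if x - t ∈ Z then 1 else 0 : ℕ)) : ℝ) = Z.card := by
      intro t _
      refine ((Equiv.subRight t).sum_comp fun y => (((if y ∈ Z then 1 else 0 : ℕ)) : ℝ)).trans ?_
      simp
    rw [Finset.sum_congr rfl translate]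
    simp
  have meet : ∀ s ∈ T, ∀ t ∈ T,
      ∑ x : X, ((if x - s ∈ Z then 1 else 0 : ℝ) * (if x - t ∈ Z then 1 else 0)) ≤
        M + if s = t then (Z.card : ℝ) - M else 0 := by
    intro s _ t _
    have shift : ∑ x : X, ((if x - s ∈ Z then 1 else 0 : ℝ) * (if x - t ∈ Z then 1 else 0)) =
        ((univ.filter fun x => x ∈ Z ∧ x - (t - s) ∈ Z).card : ℝ) := by
      rw [Finset.card_filter, Nat.cast_sum, ← (Equiv.subRight s).sum_comp
        fun x => (((if x ∈ Z ∧ x - (t - s) ∈ Z then 1 else 0 : ℕ)) : ℝ)]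
      refine Finset.sum_congr rfl fun x _ => ?_
      have : x - s - (t - s) = x - t := by abel
      simp only [Equiv.subRight_apply, this]
      by_cases h : x - s ∈ Z <;> by_cases h' : x - t ∈ Z <;> simp [h, h']
    rw [shift]
    split_ifs with h
    · subst h
      simp
    · simpa using hM (t - s) (sub_ne_zero.mpr (Ne.symm h))
  have second_moment : ∑ x : X, ((T.filter fun t => x - t ∈ Z).card : ℝ) ^ 2 ≤
      (T.card : ℝ) ^ 2 * M + T.card * (Z.card - M) := by
    calc ∑ x : X, ((T.filter fun t => x - t ∈ Z).card : ℝ) ^ 2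
        = ∑ s ∈ T, ∑ t ∈ T, ∑ x : X,
            ((if x - s ∈ Z then 1 else 0 : ℝ) * (if x - t ∈ Z then 1 else 0)) := by
          simp only [Finset.card_filter, Nat.cast_sum, sq, Finset.sum_mul_sum, Nat.cast_ite,
            Nat.cast_one, Nat.cast_zero]
          rw [Finset.sum_comm]
          exact Finset.sum_congr rfl fun s _ => Finset.sum_comm
      _ ≤ ∑ s ∈ T, ∑ t ∈ T, (M + if s = t then (Z.card : ℝ) - M else 0) :=
          Finset.sum_le_sum fun s hs => Finset.sum_le_sum fun t ht => meet s hs t ht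
      _ = (T.card : ℝ) ^ 2 * M + T.card * (Z.card - M) := by
          simp only [Finset.sum_add_distrib, Finset.sum_const, Finset.sum_ite_eq, nsmul_eq_mul]
          rw [Finset.sum_congr rfl (fun s hs => if_pos hs)]
          simp only [Finset.sum_const, nsmul_eq_mul]
          ring
  have expand : ∑ x : X, (((T.filter fun t => x - t ∈ Z).card : ℝ) - c * T.card) ^ 2 =
      ∑ x : X, ((T.filter fun t => x - t ∈ Z).card : ℝ) ^ 2
        - 2 * c * T.card * ∑ x : X, ((T.filter fun t => x - t ∈ Z).card : ℝ)
        + Fintype.card X * (c * T.card) ^ 2 := by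
    rw [Finset.mul_sum, ← Finset.sum_sub_distrib, ← Finset.card_univ, ← nsmul_eq_mul,
      ← Finset.sum_const, ← Finset.sum_add_distrib]
    exact Finset.sum_congr rfl fun x _ => by ring
  rw [expand, first_moment]
  linarith

end SecondMoment

section DotProduct
variable {F : Type*} [Field F] [Fintype F] [DecidableEq F] {k : ℕ}

lemma AddChar.IsPrimitive.sum_dotProduct {ψ : AddChar F ℂ} (hψ : ψ.IsPrimitive) (w : Fin k → F) :
    ∑ b : Fin k → F, ψ (w ⬝ᵥ b) = if w = 0 then (Fintype.card F : ℂ) ^ k else 0 := by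
  have factor : ∑ b : Fin k → F, ψ (w ⬝ᵥ b) = ∏ i, ∑ y : F, ψ (y * w i) := by
    rw [Finset.prod_univ_sum, Fintype.piFinset_univ]
    refine Finset.sum_congr rfl fun b _ => ?_
    simp only [mul_comm (b _)]
    exact map_prod ψ.toMonoidHom (fun i => Multiplicative.ofAdd (w i * b i)) univ
  rw [factor]
  simp only [AddChar.sum_mulShift _ hψ]
  split_ifs with h
  · simp [h]
  · obtain ⟨i, hi⟩ := Function.ne_iff.mp h
    exact Finset.prod_eq_zero (Finset.mem_univ i) (by simpa using hi)

/-- The number of zeros of the hyperbolic form `a ⬝ᵥ b`. -/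
lemma card_mul_card_dotProduct_eq_zero :
    (Fintype.card F : ℝ) *
        (univ.filter fun z : (Fin k → F) × (Fin k → F) => z.1 ⬝ᵥ z.2 = 0).card =
      (Fintype.card F : ℝ) ^ k * ((Fintype.card F : ℝ) ^ k + Fintype.card F - 1) := by
  obtain ⟨ψ, hψ⟩ : ∃ ψ : AddChar F ℂ, ψ.IsPrimitive :=
    ⟨_, AddChar.FiniteField.primitiveChar_to_Complex_isPrimitive F⟩
  have key : (Fintype.card F : ℂ) *
        (univ.filter fun z : (Fin k → F) × (Fin k → F) => z.1 ⬝ᵥ z.2 = 0).card =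
      (Fintype.card F : ℂ) ^ k * ((Fintype.card F : ℂ) ^ k + Fintype.card F - 1) := by
    calc _ = ∑ z : (Fin k → F) × (Fin k → F), ∑ s : F, ψ (s * (z.1 ⬝ᵥ z.2)) := by
          simp only [AddChar.sum_mulShift _ hψ]
          rw [Finset.card_filter, Nat.cast_sum, Finset.mul_sum]
          exact Finset.sum_congr rfl fun z _ => by split_ifs <;> simp
      _ = ∑ s : F, ∑ a : Fin k → F, ∑ b : Fin k → F, ψ ((s • a) ⬝ᵥ b) := by
          rw [Finset.sum_comm]
          simp only [Fintype.sum_prod_type, smul_dotProduct, smul_eq_mul]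
      _ = ∑ s : F, ∑ a : Fin k → F, if s = 0 ∨ a = 0 then (Fintype.card F : ℂ) ^ k else 0 := by
          simp only [hψ.sum_dotProduct, smul_eq_zero]
      _ = ∑ s : F, (Fintype.card F : ℂ) ^ k *
            (1 + if s = 0 then (Fintype.card F : ℂ) ^ k - 1 else 0) := by
          refine Finset.sum_congr rfl fun s _ => ?_
          by_cases h : s = 0
          · simp [h]
          · simp [h]
      _ = _ := by
          rw [← Finset.mul_sum, Finset.sum_add_distrib]
          simp
          ring
  exact_mod_cast key

lemma card_translate_dotProduct_le_of_left_ne_zero {α : Fin k → F} (hα : α ≠ 0) (β : Fin k → F) :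
    (Fintype.card F : ℝ) ^ 2 *
        (univ.filter fun z : (Fin k → F) × (Fin k → F) =>
          z.1 ⬝ᵥ z.2 = 0 ∧ (z.1 - α) ⬝ᵥ (z.2 - β) = 0).card ≤
      (Fintype.card F : ℝ) ^ k *
        ((Fintype.card F : ℝ) ^ k + (Fintype.card F : ℝ) ^ 2 - Fintype.card F) := by
  obtain ⟨ψ, hψ⟩ : ∃ ψ : AddChar F ℂ, ψ.IsPrimitive :=
    ⟨_, AddChar.FiniteField.primitiveChar_to_Complex_isPrimitive F⟩
  have key : (Fintype.card F : ℂ) ^ 2 *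
        (univ.filter fun z : (Fin k → F) × (Fin k → F) =>
          z.1 ⬝ᵥ z.2 = 0 ∧ (z.1 - α) ⬝ᵥ (z.2 - β) = 0).card =
      ∑ t : F, ∑ s : F, ∑ a : Fin k → F, ψ (-(t * ((a - α) ⬝ᵥ β))) *
        if s • a + t • (a - α) = 0 then (Fintype.card F : ℂ) ^ k else 0 := by
    calc _ = ∑ z : (Fin k → F) × (Fin k → F), (∑ t : F, ψ (t * ((z.1 - α) ⬝ᵥ (z.2 - β)))) *
            ∑ s : F, ψ (s * (z.1 ⬝ᵥ z.2)) := by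
          simp only [AddChar.sum_mulShift _ hψ]
          rw [Finset.card_filter, Nat.cast_sum, Finset.mul_sum]
          refine Finset.sum_congr rfl fun z _ => ?_
          by_cases h : z.1 ⬝ᵥ z.2 = 0 <;> by_cases h' : (z.1 - α) ⬝ᵥ (z.2 - β) = 0 <;>
            simp [h, h', sq]
      _ = ∑ t : F, ∑ s : F, ∑ a : Fin k → F, ∑ b : Fin k → F,
            ψ (t * ((a - α) ⬝ᵥ (b - β))) * ψ (s * (a ⬝ᵥ b)) := by
          simp only [Finset.sum_mul_sum]
          rw [Finset.sum_comm]
          refine Finset.sum_congr rfl fun t _ => ?_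
          rw [Finset.sum_comm]
          simp only [Fintype.sum_prod_type]
      _ = _ := by
          refine Finset.sum_congr rfl fun t _ => Finset.sum_congr rfl fun s _ =>
            Finset.sum_congr rfl fun a _ => ?_
          rw [← hψ.sum_dotProduct, Finset.mul_sum]
          refine Finset.sum_congr rfl fun b _ => ?_
          rw [← AddChar.map_add_eq_mul, ← AddChar.map_add_eq_mul]
          congr 1
          simp only [add_dotProduct, smul_dotProduct, dotProduct_sub, smul_eq_mul]
          ring
  have solutions : ∀ t s : F,
      ∑ a : Fin k → F, (if s • a + t • (a - α) = 0 then (1 : ℝ) else 0) ≤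
        (if s = -t then -1 else 0) + (1 + if s = -t then (if t = 0 then
          (Fintype.card F : ℝ) ^ k else 0) else 0) := by
    intro t s
    have collect : ∀ a : Fin k → F, s • a + t • (a - α) = 0 ↔ (s + t) • a = t • α := by
      intro a
      rw [smul_sub, ← add_sub_assoc, ← add_smul, sub_eq_zero]
    simp only [collect]
    by_cases h : s = -t
    · by_cases ht : t = 0
      · simp [h, ht]
      · have : t • α ≠ 0 := smul_ne_zero ht hα
        simp [h, ht, this.symm]
    · have hst : s + t ≠ 0 := fun h' => h (eq_neg_of_add_eq_zero_left h')
      have solve : ∀ a : Fin k → F, (s + t) • a = t • α ↔ a = (s + t)⁻¹ • t • α := by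
        intro a
        rw [eq_inv_smul_iff₀ hst]
      simp [solve, h]
  have bound : ‖(Fintype.card F : ℂ) ^ 2 *
        ((univ.filter fun z : (Fin k → F) × (Fin k → F) =>
          z.1 ⬝ᵥ z.2 = 0 ∧ (z.1 - α) ⬝ᵥ (z.2 - β) = 0).card : ℂ)‖ ≤
      ∑ t : F, ∑ s : F, (Fintype.card F : ℝ) ^ k * ((if s = -t then -1 else 0) +
        (1 + if s = -t then (if t = 0 then (Fintype.card F : ℝ) ^ k else 0) else 0)) := by
    rw [key]
    refine (norm_sum_le _ _).trans (Finset.sum_le_sum fun t _ => ?_)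
    refine (norm_sum_le _ _).trans (Finset.sum_le_sum fun s _ => ?_)
    refine (norm_sum_le _ _).trans ?_
    refine le_trans (le_of_eq ?_) (mul_le_mul_of_nonneg_left (solutions t s) (by positivity))
    rw [Finset.mul_sum]
    refine Finset.sum_congr rfl fun a _ => ?_
    rw [norm_mul, AddChar.norm_apply, one_mul]
    split_ifs <;> simp
  rw [norm_mul, norm_pow, Complex.norm_natCast, Complex.norm_natCast] at bound
  refine bound.trans (le_of_eq ?_)
  simp only [← Finset.mul_sum, Finset.sum_add_distrib, Finset.sum_ite_eq', Finset.mem_univ,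
    if_true, Finset.sum_const, Finset.card_univ, nsmul_eq_mul]
  ring

/-- The zero set of the hyperbolic form `a ⬝ᵥ b` and a proper translate of it. -/
lemma card_translate_dotProduct_le {v : (Fin k → F) × (Fin k → F)} (hv : v ≠ 0) :
    (Fintype.card F : ℝ) ^ 2 *
        (univ.filter fun z : (Fin k → F) × (Fin k → F) =>
          z.1 ⬝ᵥ z.2 = 0 ∧ (z.1 - v.1) ⬝ᵥ (z.2 - v.2) = 0).card ≤
      (Fintype.card F : ℝ) ^ k *
        ((Fintype.card F : ℝ) ^ k + (Fintype.card F : ℝ) ^ 2 - Fintype.card F) := by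
  by_cases h : v.1 = 0
  · have h' : v.2 ≠ 0 := fun h' => hv (Prod.ext h h')
    refine le_of_eq_of_le ?_ (card_translate_dotProduct_le_of_left_ne_zero h' v.1)
    congr 2
    refine Finset.card_equiv (Equiv.prodComm _ _) fun z => ?_
    simp only [Finset.mem_filter, Finset.mem_univ, true_and, Equiv.prodComm_apply, Prod.fst_swap,
      Prod.snd_swap, dotProduct_comm z.2, dotProduct_comm (z.2 - v.2)]
  · exact card_translate_dotProduct_le_of_left_ne_zero h v.2

end DotProduct

section HyperbolicForm
variable {F : Type*} [Field F] {k : ℕ}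

/-- Splitting a vector into its coordinates of even and of odd index. -/
def evenOddEquiv (F : Type*) [AddCommGroup F] (k : ℕ) :
    (Fin (k * 2) → F) ≃+ (Fin k → F) × (Fin k → F) where
  toFun x := (fun i => x (finProdFinEquiv (i, 0)), fun i => x (finProdFinEquiv (i, 1)))
  invFun z j := if (finProdFinEquiv.symm j).2 = 0 then z.1 (finProdFinEquiv.symm j).1
    else z.2 (finProdFinEquiv.symm j).1
  left_inv x := by
    funext j
    obtain ⟨⟨i, l⟩, rfl⟩ := finProdFinEquiv.surjective j
    fin_cases l <;> simp
  right_inv z := by simp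
  map_add' _ _ := rfl

lemma Q1form_eq_dotProduct (x : Fin (k * 2) → F) :
    Q1form x = (evenOddEquiv F k x).1 ⬝ᵥ (evenOddEquiv F k x).2 := by
  rw [Q1form, pairsForm, Nat.mul_div_cancel k two_pos, Finset.sum_range]
  refine Finset.sum_congr rfl fun i _ => ?_
  have hi : 2 * (i : ℕ) + 1 < k * 2 := by omega
  rw [dif_pos hi]
  congr 2 <;> ext <;> simp [finProdFinEquiv, add_comm]

variable [Fintype F] [DecidableEq F]

/-- The number of zeros of `Q₁`. -/
lemma card_mul_card_Q1form_eq_zero :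
    (Fintype.card F : ℝ) * (univ.filter fun x : Fin (k * 2) → F => Q1form x = 0).card =
      (Fintype.card F : ℝ) ^ k * ((Fintype.card F : ℝ) ^ k + Fintype.card F - 1) := by
  rw [← card_mul_card_dotProduct_eq_zero]
  congr 2
  exact Finset.card_equiv (evenOddEquiv F k).toEquiv fun x => by simp [Q1form_eq_dotProduct]

/-- Two distinct zero-radius `Q₁`-spheres have few common points. -/
lemma card_translate_Q1form_le {v : Fin (k * 2) → F} (hv : v ≠ 0) :
    (Fintype.card F : ℝ) ^ 2 *
        (univ.filter fun x : Fin (k * 2) → F => Q1form x = 0 ∧ Q1form (x - v) = 0).card ≤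
      (Fintype.card F : ℝ) ^ k *
        ((Fintype.card F : ℝ) ^ k + (Fintype.card F : ℝ) ^ 2 - Fintype.card F) := by
  have hv' : evenOddEquiv F k v ≠ 0 := by simpa using hv
  refine le_of_eq_of_le ?_ (card_translate_dotProduct_le hv')
  congr 2
  exact Finset.card_equiv (evenOddEquiv F k).toEquiv fun x => by simp [Q1form_eq_dotProduct]

/-- The second moment of the number of zero-radius `Q₁`-spheres through a point. -/
lemma sum_sq_card_Q1form_translates_le (hk : 1 ≤ k) (T : Finset (Fin (k * 2) → F)) :
    ∑ x : Fin (k * 2) → F, (((T.filter fun t => Q1form (x - t) = 0).card : ℝ)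
        - (Fintype.card F : ℝ)⁻¹ * T.card) ^ 2 ≤
      (Fintype.card F : ℝ) ^ (k * 2 - 1) * T.card
        + (Fintype.card F : ℝ) ^ k * (T.card : ℝ) ^ 2 := by
  have hq : (1 : ℝ) ≤ Fintype.card F := by exact_mod_cast Fintype.card_pos
  have hzeros := card_mul_card_Q1form_eq_zero (F := F) (k := k)
  have hmeet := fun v hv => card_translate_Q1form_le (F := F) (k := k) (v := v) hv
  have hmoment := sum_sq_card_translates_le
    (univ.filter fun x : Fin (k * 2) → F => Q1form x = 0) T (Fintype.card F : ℝ)⁻¹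
    ((Fintype.card F : ℝ) ^ k * ((Fintype.card F : ℝ) ^ k + (Fintype.card F : ℝ) ^ 2
      - Fintype.card F) / (Fintype.card F : ℝ) ^ 2) (by
      intro v hv
      rw [le_div_iff₀' (by positivity)]
      simpa using hmeet v hv)
  simp only [Finset.mem_filter, Finset.mem_univ, true_and] at hmoment
  refine hmoment.trans ?_
  have hpow : (Fintype.card F : ℝ) ^ (k * 2 - 1) =
      ((Fintype.card F : ℝ) ^ k) ^ 2 / Fintype.card F := by
    rw [eq_div_iff (by positivity), ← pow_succ, ← pow_mul, Nat.sub_add_cancel (by omega)]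
  have hspace : (Fintype.card (Fin (k * 2) → F) : ℝ) = ((Fintype.card F : ℝ) ^ k) ^ 2 := by
    simp [pow_mul]
  rw [hpow, hspace]
  rw [mul_comm, ← eq_div_iff (by positivity)] at hzeros
  rw [hzeros]
  have hK : (0 : ℝ) ≤ (Fintype.card F : ℝ) ^ k := by positivity
  generalize (Fintype.card F : ℝ) ^ k = K at *
  generalize (Fintype.card F : ℝ) = q at *
  have hn : (0 : ℝ) ≤ T.card := by positivity
  generalize (T.card : ℝ) = n at *
  have hq0 : q ≠ 0 := by positivity
  rw [← sub_nonneg]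
  have gap : K ^ 2 / q * n + K * n ^ 2 - (n * (K * (K + q - 1) / q)
      + (n ^ 2 - n) * (K * (K + q ^ 2 - q) / q ^ 2)
      - 2 * q⁻¹ * n ^ 2 * (K * (K + q - 1) / q) + q⁻¹ ^ 2 * n ^ 2 * K ^ 2) =
      (n * K ^ 2 + n ^ 2 * K * (3 * q - 2)) / q ^ 2 := by
    field_simp
    ring
  rw [gap]
  have : 0 ≤ 3 * q - 2 := by linarith
  positivity

end HyperbolicForm

/-- Incidence bound for zero-radius `Q₁^d`-spheres (even `d`), for all
sufficiently large odd prime powers `q`. -/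
theorem stmt5 (d : ℕ) (hd : 4 ≤ d) (hdeven : Even d) :
    ∀ ε : ℝ, 0 < ε → ∃ q₀ : ℕ,
      ∀ (F : Type) [Field F] [Fintype F] [DecidableEq F],
        Odd (Fintype.card F) → q₀ ≤ Fintype.card F →
        ∀ (P : Finset (Fin d → F)) (S : Finset ((Fin d → F) × F)),
          (∀ s ∈ S, s.2 = 0) →
          |(sphIncid Q1form P S : ℝ) - (Fintype.card F : ℝ)⁻¹ * P.card * S.card|
            ≤ (1 + ε) * Real.sqrt ((P.card : ℝ) *
                ((Fintype.card F : ℝ) ^ (d-1) * S.card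
                  + (Fintype.card F : ℝ) ^ (d/2) * (S.card : ℝ) ^ 2)) := by
  intro ε hε
  refine ⟨0, ?_⟩
  intro F _ _ _ _ _ P S hS
  obtain ⟨k, rfl⟩ : ∃ k, d = k * 2 := hdeven.exists_two_nsmul d |>.imp fun k hk => by
    simpa [mul_comm] using hk
  rw [Nat.mul_div_cancel k two_pos]
  have hinj : Set.InjOn Prod.fst (S : Set ((Fin (k * 2) → F) × F)) := by
    intro s hs t ht hst
    exact Prod.ext hst ((hS s hs).trans (hS t ht).symm)
  have hcard : (S.image Prod.fst).card = S.card := Finset.card_image_of_injOn hinj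
  have hincid : (sphIncid Q1form P S : ℝ) =
      ∑ x ∈ P, (((S.image Prod.fst).filter fun t => Q1form (x - t) = 0).card : ℝ) := by
    rw [sphIncid, Finset.card_filter, Finset.sum_product, Nat.cast_sum]
    refine Finset.sum_congr rfl fun x _ => ?_
    rw [Finset.card_filter, Finset.sum_image hinj]
    congr 1
    exact Finset.sum_congr rfl fun s hs => by rw [hS s hs]
  have hmoment := sum_sq_card_Q1form_translates_le (F := F) (k := k) (by omega) (S.image Prod.fst)
  rw [hcard] at hmoment
  have hsum : (sphIncid Q1form P S : ℝ) - (Fintype.card F : ℝ)⁻¹ * P.card * S.card =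
      ∑ x ∈ P, ((((S.image Prod.fst).filter fun t => Q1form (x - t) = 0).card : ℝ)
        - (Fintype.card F : ℝ)⁻¹ * S.card) := by
    rw [hincid, Finset.sum_sub_distrib, Finset.sum_const, nsmul_eq_mul]
    ring
  rw [hsum]
  refine le_trans (Real.abs_le_sqrt ?_)
    (le_mul_of_one_le_left (Real.sqrt_nonneg _) (by linarith))
  refine sq_sum_le_card_mul_sum_sq.trans (mul_le_mul_of_nonneg_left ?_ (by positivity))
  exact (Finset.sum_le_univ_sum_of_nonneg fun x => sq_nonneg _).trans hmoment
end

section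
/- Let d ≥ 3 be odd, let q be an odd prime power, let i ∈ {3,4}, and let R ⊆ F_q \ {0} be a set such that (−1)^{i+1}·η(−r) = −1 for every r ∈ R. Let P ⊆ F_q^d and let S be a set of Q_i^d-spheres with radii in R. Then |I(P,S) − q^{−1}|P||S|| ≤ q^{(d−1)/2}|P|^{1/2}|S|^{1/2} + √3 · q^{(d−3)/4}|P|^{1/2}|S|. -/
open Finset

/-- An affine conic in the plane whose quadratic part `c w² + r u²` is anisotropic has at most
`q + 1` points. -/
lemma card_anisotropic_conic_le {F : Type*} [Field F] [Fintype F] [DecidableEq F]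
    {c r : F} (hani : ∀ w u : F, c * w ^ 2 + r * u ^ 2 = 0 → w = 0 ∧ u = 0) (k e : F) :
    #{p : F × F | c * p.1 ^ 2 + r * p.2 ^ 2 + k * p.2 + e = 0} ≤ Fintype.card F + 1 := by
  set T : Finset (F × F) := {p : F × F | c * p.1 ^ 2 + r * p.2 ^ 2 + k * p.2 + e = 0} with hT
  rcases T.eq_empty_or_nonempty with h | ⟨⟨w₀, u₀⟩, hp⟩
  · simp [h]
  have hp₀ : c * w₀ ^ 2 + r * u₀ ^ 2 + k * u₀ + e = 0 := by simpa [hT] using hp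
  have hr : r ≠ 0 := fun h => one_ne_zero (hani 0 1 (by simp [h])).2
  have hslope : ∀ t, c + r * t ^ 2 ≠ 0 := fun t h =>
    one_ne_zero (hani 1 t (by linear_combination h)).1
  -- the second intersection of the conic with the line through `(w₀, u₀)` of slope `t`
  let f : Option F → F × F := fun o => o.elim
    (w₀, u₀ - (2 * r * u₀ + k) / r)
    (fun t => (w₀ - (2 * c * w₀ + (2 * r * u₀ + k) * t) / (c + r * t ^ 2),
      u₀ - (2 * c * w₀ + (2 * r * u₀ + k) * t) / (c + r * t ^ 2) * t))
  have hsub : T ⊆ univ.image f := by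
    rintro ⟨w, u⟩ hwu
    have hwu' : c * w ^ 2 + r * u ^ 2 + k * u + e = 0 := by simpa [hT] using hwu
    rw [mem_image]
    by_cases hw : w = w₀
    · subst hw
      by_cases hu : u = u₀
      · subst hu
        by_cases hl : 2 * r * u + k = 0
        · exact ⟨none, mem_univ _, by simp [f, hl]⟩
        · refine ⟨some (-(2 * c * w) / (2 * r * u + k)), mem_univ _, ?_⟩
          have : 2 * c * w + (2 * r * u + k) * (-(2 * c * w) / (2 * r * u + k)) = 0 := by
            field_simp
            ring
          simp [f, this]
      · refine ⟨none, mem_univ _, ?_⟩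
        have h1 : (u - u₀) * (r * (u + u₀) + k) = 0 := by linear_combination hwu' - hp₀
        have h2 := (mul_eq_zero.1 h1).resolve_left (sub_ne_zero.2 hu)
        simp only [f, Option.elim, Prod.mk.injEq, true_and]
        field_simp
        linear_combination -h2
    · have hw' : w - w₀ ≠ 0 := sub_ne_zero.2 hw
      refine ⟨some ((u - u₀) / (w - w₀)), mem_univ _, ?_⟩
      have hA := hslope ((u - u₀) / (w - w₀))
      have key : (2 * c * w₀ + (2 * r * u₀ + k) * ((u - u₀) / (w - w₀))) /
          (c + r * ((u - u₀) / (w - w₀)) ^ 2) = -(w - w₀) := by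
        rw [div_eq_iff hA]
        field_simp
        linear_combination hwu' - hp₀
      simp only [f, Option.elim, Prod.mk.injEq, key]
      constructor
      · ring
      · field_simp
        ring
  calc #T ≤ #(univ.image f) := card_le_card hsub
    _ ≤ #(univ : Finset (Option F)) := card_image_le
    _ = Fintype.card F + 1 := by simp

/-- If `-c y²` never takes the value `r`, the conic `-c y² = r + k γ + e γ²` has at most `q + 1`
points. -/
lemma card_conic_le {F : Type*} [Field F] [Fintype F] [DecidableEq F]
    {c r : F} (hc : c ≠ 0) (hr : ∀ y, -(c * y ^ 2) ≠ r) (k e : F) :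
    #{p : F × F | -(c * p.2 ^ 2) = r + p.1 * k + p.1 ^ 2 * e} ≤ Fintype.card F + 1 := by
  have hani : ∀ w u : F, c * w ^ 2 + r * u ^ 2 = 0 → w = 0 ∧ u = 0 := by
    intro w u h
    by_cases hu : u = 0
    · subst hu
      simpa [hc] using h
    · refine absurd ?_ (hr (w / u))
      field_simp
      linear_combination -h
  refine le_trans (card_le_card_of_injOn (fun p => (p.2 / p.1, 1 / p.1)) ?_ ?_)
    (card_anisotropic_conic_le hani k e)
  · rintro ⟨γ, y⟩ h
    simp only [coe_filter, mem_univ, true_and, Set.mem_ofPred_eq] at h ⊢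
    have hγ : γ ≠ 0 := by
      rintro rfl
      exact hr y (by simpa using h)
    field_simp
    linear_combination -h
  · rintro ⟨γ, y⟩ h ⟨γ', y'⟩ h' heq
    simp only [coe_filter, mem_univ, true_and, Set.mem_ofPred_eq] at h h'
    have hγ : γ ≠ 0 := by
      rintro rfl
      exact hr y (by simpa using h)
    simp only [Prod.mk.injEq, one_div, inv_inj] at heq
    obtain ⟨h1, rfl⟩ := heq
    simpa [div_left_inj' hγ] using h1

/-- The fibres of a nonzero linear form have `|V| / q` elements. -/
lemma card_mul_card_linear_fiber {F V : Type*} [Field F] [Fintype F] [DecidableEq F]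
    [AddCommGroup V] [Module F V] [Fintype V]
    {l : V →ₗ[F] F} (hl : l ≠ 0) (k : F) :
    Fintype.card F * #{x | l x = k} = Fintype.card V := by
  obtain ⟨w, hw⟩ := LinearMap.surjective hl 1
  have hfib : ∀ j, #{x | l x = j} = #{x | l x = k} := by
    intro j
    refine card_bij' (fun x _ => x + (k - j) • w) (fun x _ => x + (j - k) • w) ?_ ?_ ?_ ?_
    · intro x hx
      simp_all
    · intro x hx
      simp_all
    · intro x _
      simp only [add_assoc, ← add_smul]
      simp
    · intro x _
      simp only [add_assoc, ← add_smul]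
      simp
  rw [← card_univ (α := V), ← card_univ (α := F), ← smul_eq_mul, ← sum_const,
    card_eq_sum_card_fiberwise (s := (univ : Finset V)) (f := l) (t := univ)
      (fun x _ => mem_coe.2 (mem_univ _))]
  exact (sum_congr rfl fun j _ => hfib j).symm

/-- Counting the pairs `(x, γ)` with `Q x + γ B v x = r + γ k` in two ways expresses the number of
points on a hyperplane section of a quadric by the number of points on a plane conic. -/
lemma card_mul_card_quadric_inter_hyperplane {F V : Type*} [Field F] [Fintype F] [DecidableEq F]
    [AddCommGroup V] [Module F V] [Fintype V] {m : ℕ} {c : F} {Q : V → F} {B : V → V →ₗ[F] F}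
    (hQ : ∀ x v γ, Q (x + γ • v) = Q x + γ * B v x + γ ^ 2 * Q v)
    (hcard : Fintype.card V = Fintype.card F ^ (2 * m + 1))
    (hcount : ∀ t, #{x | Q x = t} + Fintype.card F ^ m =
      Fintype.card F ^ (2 * m) + Fintype.card F ^ m * #{y : F | -(c * y ^ 2) = t})
    {v : V} (hv : B v ≠ 0) (r k : F) :
    Fintype.card F * #{x | Q x = r ∧ B v x = k} + Fintype.card F ^ (m + 1) =
      Fintype.card F ^ (2 * m) +
        Fintype.card F ^ m * #{p : F × F | -(c * p.2 ^ 2) = r + p.1 * k + p.1 ^ 2 * Q v} := by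
  set q := Fintype.card F with hqdef
  have hq : 0 < q := Fintype.card_pos
  have hfib : #{x | B v x = k} = q ^ (2 * m) := by
    have h := card_mul_card_linear_fiber hv k
    rw [hcard, pow_succ'] at h
    exact Nat.eq_of_mul_eq_mul_left hq h
  have hγ : ∀ x, #{γ : F | Q x + γ * B v x = r + γ * k} + (if B v x = k then 1 else 0) =
      (if Q x = r ∧ B v x = k then q else 0) + 1 := by
    intro x
    by_cases hB : B v x = k
    · by_cases hx : Q x = r <;> simp [hB, hx, hqdef]
    · have : ({γ : F | Q x + γ * B v x = r + γ * k} : Finset F) = {(r - Q x) / (B v x - k)} := by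
        ext γ
        have := sub_ne_zero.2 hB
        simp only [mem_filter, mem_univ, true_and, mem_singleton, eq_div_iff this]
        constructor <;> intro h <;> linear_combination h
      simp [hB, this]
  have hx : ∀ γ, #{x | Q x + γ * B v x = r + γ * k} + q ^ m =
      q ^ (2 * m) + q ^ m * #{y : F | -(c * y ^ 2) = r + γ * k + γ ^ 2 * Q v} := by
    intro γ
    rw [← hcount]
    congr 1
    refine card_equiv (Equiv.addRight (γ • v)) fun x => ?_
    simp only [mem_filter, mem_univ, true_and, Equiv.coe_addRight, hQ]
    constructor <;> intro h <;> linear_combination h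
  have hswap : ∑ x, #{γ : F | Q x + γ * B v x = r + γ * k} =
      ∑ γ, #{x | Q x + γ * B v x = r + γ * k} := by
    simp only [card_filter]
    exact sum_comm
  have h1 := sum_congr (rfl : (univ : Finset V) = univ) fun x _ => hγ x
  have h2 := sum_congr (rfl : (univ : Finset F) = univ) fun γ _ => hx γ
  have hM : #{p : F × F | -(c * p.2 ^ 2) = r + p.1 * k + p.1 ^ 2 * Q v} =
      ∑ γ : F, #{y : F | -(c * y ^ 2) = r + γ * k + γ ^ 2 * Q v} := by
    simp only [card_filter, Fintype.sum_prod_type]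
  rw [sum_add_distrib, sum_add_distrib, ← card_filter, hfib, ← sum_filter, sum_const, sum_const,
    card_univ, hcard, smul_eq_mul, smul_eq_mul, mul_one] at h1
  rw [sum_add_distrib, sum_add_distrib, sum_const, sum_const, card_univ, ← mul_sum, ← hM,
    smul_eq_mul, smul_eq_mul, ← hswap] at h2
  rw [← hqdef] at h2
  have e1 : q ^ (2 * m + 1) = q * q ^ (2 * m) := by ring
  have e2 : q ^ (m + 1) = q * q ^ m := by ring
  rw [e1] at h1
  rw [e2]
  linarith

/-- Two distinct spheres meet in at most `q ^ (2m-1) + q ^ (m-1)` points, provided the first radius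
is not a value of `-c y²`. -/
lemma card_sphere_inter_sphere_le {F V : Type*} [Field F] [Fintype F] [DecidableEq F]
    [AddCommGroup V] [Module F V] [Fintype V] {m : ℕ} {c : F} {Q : V → F} {B : V → V →ₗ[F] F}
    (hQ : ∀ x v γ, Q (x + γ • v) = Q x + γ * B v x + γ ^ 2 * Q v)
    (hB : ∀ v, v ≠ 0 → B v ≠ 0)
    (hcard : Fintype.card V = Fintype.card F ^ (2 * m + 1))
    (hcount : ∀ t, #{x | Q x = t} + Fintype.card F ^ m =
      Fintype.card F ^ (2 * m) + Fintype.card F ^ m * #{y : F | -(c * y ^ 2) = t})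
    (hc : c ≠ 0) {s t : V × F} (hs : ∀ y, -(c * y ^ 2) ≠ s.2) (hst : s ≠ t) :
    Fintype.card F * #{x | Q (x - s.1) = s.2 ∧ Q (x - t.1) = t.2} ≤
      Fintype.card F ^ (2 * m) + Fintype.card F ^ m := by
  by_cases hv : s.1 - t.1 = 0
  · have hcen : s.1 = t.1 := sub_eq_zero.1 hv
    have : ({x | Q (x - s.1) = s.2 ∧ Q (x - t.1) = t.2} : Finset V) = ∅ := by
      refine filter_eq_empty_iff.2 fun x _ h => hst (Prod.ext hcen ?_)
      rw [← h.1, ← h.2, hcen]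
    simp [this]
  · have heq : #{x | Q (x - s.1) = s.2 ∧ Q (x - t.1) = t.2} =
        #{x | Q x = s.2 ∧ B (s.1 - t.1) x = t.2 - s.2 - Q (s.1 - t.1)} := by
      refine card_equiv (Equiv.subRight s.1) fun x => ?_
      have h := hQ (x - s.1) (s.1 - t.1) 1
      simp only [one_smul, sub_add_sub_cancel, one_mul, one_pow] at h
      simp only [mem_filter, mem_univ, true_and, Equiv.subRight_apply]
      rw [h]
      refine and_congr_right fun h' => ?_
      rw [h']
      constructor <;> intro h <;> linear_combination h
    have h1 := card_mul_card_quadric_inter_hyperplane hQ hcard hcount (hB _ hv) s.2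
      (t.2 - s.2 - Q (s.1 - t.1))
    have h2 := card_conic_le hc hs (t.2 - s.2 - Q (s.1 - t.1)) (Q (s.1 - t.1))
    have h3 := Nat.mul_le_mul_left (Fintype.card F ^ m) h2
    rw [heq]
    have e2 : Fintype.card F ^ (m + 1) = Fintype.card F ^ m * Fintype.card F := by ring
    rw [e2] at h1
    linarith

/-- Second moment of the number of spheres through a point. -/
lemma sum_sq_sphere_deviation_le {F V : Type*} [Field F] [Fintype F] [DecidableEq F]
    [AddCommGroup V] [Module F V] [Fintype V] [DecidableEq V]
    {m : ℕ} {c : F} {Q : V → F} {B : V → V →ₗ[F] F}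
    (hQ : ∀ x v γ, Q (x + γ • v) = Q x + γ * B v x + γ ^ 2 * Q v)
    (hB : ∀ v, v ≠ 0 → B v ≠ 0)
    (hcard : Fintype.card V = Fintype.card F ^ (2 * m + 1))
    (hcount : ∀ t, #{x | Q x = t} + Fintype.card F ^ m =
      Fintype.card F ^ (2 * m) + Fintype.card F ^ m * #{y : F | -(c * y ^ 2) = t})
    (hc : c ≠ 0) (S : Finset (V × F)) (hS : ∀ s ∈ S, ∀ y, -(c * y ^ 2) ≠ s.2) :
    ∑ x, ((#{s ∈ S | Q (x - s.1) = s.2} : ℝ) - (Fintype.card F : ℝ)⁻¹ * #S) ^ 2 ≤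
      (Fintype.card F : ℝ) ^ (2 * m) * #S
        + 3 * (Fintype.card F : ℝ) ^ m * (Fintype.card F : ℝ)⁻¹ * (#S : ℝ) ^ 2 := by
  set q : ℝ := (Fintype.card F : ℝ) with hqdef
  have hq : 0 < q := by
    rw [hqdef]
    exact_mod_cast Fintype.card_pos
  have hsphere : ∀ s ∈ S, (#{x | Q (x - s.1) = s.2} : ℝ) = q ^ (2 * m) - q ^ m := by
    intro s hs
    have h1 : #{x | Q (x - s.1) = s.2} = #{x | Q x = s.2} :=
      card_equiv (Equiv.subRight s.1) fun x => by simp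
    have h2 := hcount s.2
    rw [filter_false_of_mem fun y _ => hS s hs y, card_empty, mul_zero, add_zero] at h2
    rw [h1, eq_sub_iff_add_eq, hqdef]
    exact_mod_cast h2
  have hpair : ∀ s ∈ S, ∀ t ∈ S, (#{x | Q (x - s.1) = s.2 ∧ Q (x - t.1) = t.2} : ℝ) ≤
      (if s = t then q ^ (2 * m) else 0) + (q ^ (2 * m) + q ^ m) * q⁻¹ := by
    intro s hs t _
    split_ifs with hst
    · subst hst
      simp only [and_self, hsphere s hs]
      have : 0 ≤ (q ^ (2 * m) + q ^ m) * q⁻¹ := by positivity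
      have : 0 ≤ q ^ m := by positivity
      linarith
    · rw [zero_add, ← div_eq_mul_inv, le_div_iff₀' hq, hqdef]
      exact_mod_cast card_sphere_inter_sphere_le hQ hB hcard hcount hc (hS s hs) hst
  have hfirst : ∑ x, (#{s ∈ S | Q (x - s.1) = s.2} : ℝ) = #S * (q ^ (2 * m) - q ^ m) := by
    have : ∀ x, (#{s ∈ S | Q (x - s.1) = s.2} : ℝ) =
        ∑ s ∈ S, if Q (x - s.1) = s.2 then (1 : ℝ) else 0 := fun x => by simp
    simp only [this]
    rw [sum_comm, ← nsmul_eq_mul, ← sum_const]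
    refine sum_congr rfl fun s hs => ?_
    rw [← hsphere s hs]
    simp
  have hsecond : ∑ x, (#{s ∈ S | Q (x - s.1) = s.2} : ℝ) ^ 2 =
      ∑ s ∈ S, ∑ t ∈ S, (#{x | Q (x - s.1) = s.2 ∧ Q (x - t.1) = t.2} : ℝ) := by
    have : ∀ x, (#{s ∈ S | Q (x - s.1) = s.2} : ℝ) ^ 2 =
        ∑ s ∈ S, ∑ t ∈ S, if Q (x - s.1) = s.2 ∧ Q (x - t.1) = t.2 then (1 : ℝ) else 0 := by
      intro x
      simp only [ite_and, sq, card_filter, Nat.cast_sum, sum_mul_sum]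
      refine sum_congr rfl fun s _ => sum_congr rfl fun t _ => ?_
      split_ifs <;> simp
    simp only [this]
    rw [sum_comm]
    refine sum_congr rfl fun s _ => ?_
    rw [sum_comm]
    simp
  have hsecond_le : ∑ x, (#{s ∈ S | Q (x - s.1) = s.2} : ℝ) ^ 2 ≤
      #S * q ^ (2 * m) + (#S : ℝ) ^ 2 * ((q ^ (2 * m) + q ^ m) * q⁻¹) := by
    rw [hsecond]
    calc _ ≤ ∑ s ∈ S, ∑ t ∈ S,
          ((if s = t then q ^ (2 * m) else 0) + (q ^ (2 * m) + q ^ m) * q⁻¹) :=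
        sum_le_sum fun s hs => sum_le_sum fun t ht => hpair s hs t ht
      _ = _ := by
        simp only [sum_add_distrib, sum_ite_eq, sum_const, nsmul_eq_mul]
        rw [sum_congr rfl fun s hs => if_pos hs, sum_const, nsmul_eq_mul]
        ring
  have hexp : ∑ x, ((#{s ∈ S | Q (x - s.1) = s.2} : ℝ) - q⁻¹ * #S) ^ 2 =
      ∑ x, (#{s ∈ S | Q (x - s.1) = s.2} : ℝ) ^ 2
        - 2 * (q⁻¹ * #S) * (#S * (q ^ (2 * m) - q ^ m))
        + q ^ (2 * m + 1) * (q⁻¹ * #S) ^ 2 := by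
    have hV : (Fintype.card V : ℝ) = q ^ (2 * m + 1) := by
      rw [hcard, hqdef]
      push_cast
      rfl
    rw [← hfirst, ← hV, mul_sum, ← sum_sub_distrib, ← card_univ, ← nsmul_eq_mul, ← sum_const,
      ← sum_add_distrib]
    exact sum_congr rfl fun x _ => by ring
  rw [hexp]
  have hlast : q ^ (2 * m + 1) * (q⁻¹ * #S) ^ 2 = q ^ (2 * m) * q⁻¹ * (#S : ℝ) ^ 2 := by
    field_simp
    ring
  rw [hlast]
  linarith

/-- The deviation of the incidence count, for a form whose values are distributed like those of
a sum of `m` hyperbolic planes and `-c y²`. -/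
lemma abs_incidences_sub_le {F V : Type*} [Field F] [Fintype F] [DecidableEq F]
    [AddCommGroup V] [Module F V] [Fintype V] [DecidableEq V]
    {m : ℕ} {c : F} {Q : V → F} {B : V → V →ₗ[F] F}
    (hQ : ∀ x v γ, Q (x + γ • v) = Q x + γ * B v x + γ ^ 2 * Q v)
    (hB : ∀ v, v ≠ 0 → B v ≠ 0)
    (hcard : Fintype.card V = Fintype.card F ^ (2 * m + 1))
    (hcount : ∀ t, #{x | Q x = t} + Fintype.card F ^ m =
      Fintype.card F ^ (2 * m) + Fintype.card F ^ m * #{y : F | -(c * y ^ 2) = t})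
    (hc : c ≠ 0) (P : Finset V) (S : Finset (V × F)) (hS : ∀ s ∈ S, ∀ y, -(c * y ^ 2) ≠ s.2) :
    |(#{z ∈ P ×ˢ S | Q (z.1 - z.2.1) = z.2.2} : ℝ) - (Fintype.card F : ℝ)⁻¹ * #P * #S| ≤
      (Fintype.card F : ℝ) ^ m * √(#P) * √(#S)
        + √3 * √((Fintype.card F : ℝ) ^ m * (Fintype.card F : ℝ)⁻¹) * √(#P) * #S := by
  set q : ℝ := (Fintype.card F : ℝ)
  have hdev : (#{z ∈ P ×ˢ S | Q (z.1 - z.2.1) = z.2.2} : ℝ) - q⁻¹ * #P * #S =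
      ∑ x ∈ P, ((#{s ∈ S | Q (x - s.1) = s.2} : ℝ) - q⁻¹ * #S) := by
    rw [sum_sub_distrib, sum_const, nsmul_eq_mul, card_filter, sum_product]
    simp only [card_filter]
    push_cast
    ring
  have hsq : (∑ x ∈ P, ((#{s ∈ S | Q (x - s.1) = s.2} : ℝ) - q⁻¹ * #S)) ^ 2 ≤
      #P * (q ^ (2 * m) * #S + 3 * q ^ m * q⁻¹ * (#S : ℝ) ^ 2) := by
    refine sq_sum_le_card_mul_sum_sq.trans (mul_le_mul_of_nonneg_left ?_ (Nat.cast_nonneg _))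
    exact (sum_le_sum_of_subset_of_nonneg (subset_univ P) fun _ _ _ => sq_nonneg _).trans
      (sum_sq_sphere_deviation_le hQ hB hcard hcount hc S hS)
  rw [hdev]
  refine abs_le_of_sq_le_sq (hsq.trans ?_) (by positivity)
  have h1 : (q ^ m * √(#P) * √(#S)) ^ 2 = #P * (q ^ (2 * m) * #S) := by
    rw [mul_pow, mul_pow, Real.sq_sqrt (Nat.cast_nonneg _), Real.sq_sqrt (Nat.cast_nonneg _)]
    ring
  have h2 : (√3 * √(q ^ m * q⁻¹) * √(#P) * #S) ^ 2 =
      #P * (3 * q ^ m * q⁻¹ * (#S : ℝ) ^ 2) := by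
    rw [mul_pow, mul_pow, mul_pow, Real.sq_sqrt (Nat.cast_nonneg _),
      Real.sq_sqrt (by positivity), Real.sq_sqrt (by positivity)]
    ring
  have h3 : 0 ≤ (q ^ m * √(#P) * √(#S)) * (√3 * √(q ^ m * q⁻¹) * √(#P) * #S) := by positivity
  rw [mul_add, ← h1, ← h2]
  nlinarith

section HyperbolicForm
variable {F : Type*} [Field F]

/-- The polar form of `pairsForm`. -/
def pairsPolar {d : ℕ} (k : ℕ) (v x : Fin d → F) : F :=
  ∑ j ∈ Finset.range k, if h : 2 * j + 1 < d then
    v ⟨2 * j, by omega⟩ * x ⟨2 * j + 1, h⟩ + v ⟨2 * j + 1, h⟩ * x ⟨2 * j, by omega⟩ else 0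

/-- The form `x₁x₂ + ⋯ + x_{2m-1}x_{2m} - c x_{2m+1}²`. -/
def oddForm (c : F) (m : ℕ) (x : Fin (2 * m + 1) → F) : F :=
  pairsForm m x - c * x (Fin.last _) ^ 2

/-- The polar form of `oddForm`, as a linear form in the second variable. -/
def oddPolar (c : F) (m : ℕ) (v : Fin (2 * m + 1) → F) : (Fin (2 * m + 1) → F) →ₗ[F] F where
  toFun x := pairsPolar m v x - 2 * c * v (Fin.last _) * x (Fin.last _)
  map_add' x y := by
    have : pairsPolar m v (x + y) = pairsPolar m v x + pairsPolar m v y := by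
      simp only [pairsPolar, ← sum_add_distrib]
      refine sum_congr rfl fun j _ => ?_
      split_ifs
      · simp only [Pi.add_apply]
        ring
      · simp
    rw [this, Pi.add_apply]
    ring
  map_smul' γ x := by
    have : pairsPolar m v (γ • x) = γ * pairsPolar m v x := by
      simp only [pairsPolar, mul_sum]
      refine sum_congr rfl fun j _ => ?_
      split_ifs
      · simp only [Pi.smul_apply, smul_eq_mul]
        ring
      · simp
    rw [this, Pi.smul_apply, smul_eq_mul, smul_eq_mul, RingHom.id_apply]
    ring

lemma oddForm_add_smul (c : F) (m : ℕ) (x v : Fin (2 * m + 1) → F) (γ : F) :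
    oddForm c m (x + γ • v) = oddForm c m x + γ * oddPolar c m v x + γ ^ 2 * oddForm c m v := by
  have : pairsForm m (x + γ • v) =
      pairsForm m x + γ * pairsPolar m v x + γ ^ 2 * pairsForm m v := by
    simp only [pairsForm, pairsPolar, mul_sum, ← sum_add_distrib]
    refine sum_congr rfl fun j _ => ?_
    split_ifs
    · simp only [Pi.add_apply, Pi.smul_apply, smul_eq_mul]
      ring
    · simp
  simp only [oddForm, oddPolar, this, LinearMap.coe_mk, AddHom.coe_mk, Pi.add_apply,
    Pi.smul_apply, smul_eq_mul]
  ring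

lemma oddPolar_apply_single_last (c : F) (m : ℕ) (v : Fin (2 * m + 1) → F) :
    oddPolar c m v (Pi.single (Fin.last _) 1) = -(2 * c * v (Fin.last _)) := by
  have : pairsPolar m v (Pi.single (Fin.last _) 1) = 0 := by
    refine sum_eq_zero fun j hj => ?_
    have := mem_range.1 hj
    split_ifs
    · rw [Pi.single_eq_of_ne, Pi.single_eq_of_ne]
      · simp
      · simp only [ne_eq, Fin.ext_iff, Fin.val_last]
        omega
      · simp only [ne_eq, Fin.ext_iff, Fin.val_last]
        omega
    · rfl
  simp [oddPolar, this]

lemma oddPolar_apply_single_even (c : F) (m : ℕ) (v : Fin (2 * m + 1) → F) {j : ℕ} (hj : j < m) :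
    oddPolar c m v (Pi.single ⟨2 * j, by omega⟩ 1) = v ⟨2 * j + 1, by omega⟩ := by
  have hlast : (Pi.single ⟨2 * j, by omega⟩ 1 : Fin (2 * m + 1) → F) (Fin.last _) = 0 := by
    rw [Pi.single_eq_of_ne]
    simp only [ne_eq, Fin.ext_iff, Fin.val_last]
    omega
  have : pairsPolar m v (Pi.single ⟨2 * j, by omega⟩ 1) = v ⟨2 * j + 1, by omega⟩ := by
    rw [pairsPolar, sum_eq_single j]
    · simp [show 2 * j < 2 * m by omega]
    · intro i _ hij
      simp only [Pi.single_apply, Fin.ext_iff]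
      split_ifs <;> first | omega | simp
    · intro h
      exact absurd (mem_range.2 hj) h
  simp [oddPolar, this, hlast]

lemma oddPolar_apply_single_odd (c : F) (m : ℕ) (v : Fin (2 * m + 1) → F) {j : ℕ} (hj : j < m) :
    oddPolar c m v (Pi.single ⟨2 * j + 1, by omega⟩ 1) = v ⟨2 * j, by omega⟩ := by
  have hlast : (Pi.single ⟨2 * j + 1, by omega⟩ 1 : Fin (2 * m + 1) → F) (Fin.last _) = 0 := by
    rw [Pi.single_eq_of_ne]
    simp only [ne_eq, Fin.ext_iff, Fin.val_last]
    omega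
  have : pairsPolar m v (Pi.single ⟨2 * j + 1, by omega⟩ 1) = v ⟨2 * j, by omega⟩ := by
    rw [pairsPolar, sum_eq_single j]
    · simp [show 2 * j < 2 * m by omega]
    · intro i _ hij
      simp only [Pi.single_apply, Fin.ext_iff]
      split_ifs <;> first | omega | simp
    · intro h
      exact absurd (mem_range.2 hj) h
  simp [oddPolar, this, hlast]

lemma oddPolar_ne_zero {c : F} (hc : c ≠ 0) (h2 : (2 : F) ≠ 0) (m : ℕ)
    (v : Fin (2 * m + 1) → F) (hv : v ≠ 0) : oddPolar c m v ≠ 0 := by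
  contrapose! hv
  ext ⟨n, hn⟩
  rcases Nat.even_or_odd' n with ⟨j, rfl | rfl⟩
  · rcases Nat.lt_or_ge j m with hj | hj
    · rw [← oddPolar_apply_single_odd c m v hj, hv]
      rfl
    · have h := oddPolar_apply_single_last c m v
      obtain rfl : j = m := by omega
      rw [hv] at h
      simpa [hc, h2, Fin.last] using h
  · rw [← oddPolar_apply_single_even c m v (by omega), hv]
    rfl

lemma oddForm_cons_cons (c : F) (m : ℕ) (a b : F) (x : Fin (2 * m + 1) → F) :
    oddForm c (m + 1) (Fin.cons a (Fin.cons b x : Fin (2 * m + 2) → F)) =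
      a * b + oddForm c m x := by
  have hpairs : pairsForm (m + 1) (Fin.cons a (Fin.cons b x : Fin (2 * m + 2) → F) :
      Fin (2 * m + 3) → F) = pairsForm m x + a * b := by
    rw [pairsForm, sum_range_succ']
    congr 1
    refine sum_congr rfl fun j hj => ?_
    have := mem_range.1 hj
    rw [dif_pos (by omega), dif_pos (by omega)]
    rfl
  have hlast : (Fin.cons a (Fin.cons b x : Fin (2 * m + 2) → F) : Fin (2 * m + 3) → F)
      (Fin.last _) = x (Fin.last _) := rfl
  change pairsForm (m + 1) (Fin.cons a (Fin.cons b x : Fin (2 * m + 2) → F) :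
      Fin (2 * m + 3) → F) - c * (Fin.cons a (Fin.cons b x : Fin (2 * m + 2) → F) :
      Fin (2 * m + 3) → F) (Fin.last _) ^ 2 = _
  rw [hpairs, hlast, oddForm]
  ring

variable [Fintype F] [DecidableEq F]

/-- The number of solutions of `a b + f x = t`. -/
lemma card_mul_add_eq {V : Type*} [Fintype V] (f : V → F) (t : F) :
    #{p : F × F × V | p.1 * p.2.1 + f p.2.2 = t} + Fintype.card V =
      Fintype.card F * Fintype.card V + Fintype.card F * #{x | f x = t} := by
  have hab : ∀ a x, #{b : F | a * b + f x = t} + (if a = 0 then 1 else 0) =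
      1 + if a = 0 then (if f x = t then Fintype.card F else 0) else 0 := by
    intro a x
    by_cases ha : a = 0
    · by_cases hx : f x = t <;> simp [ha, hx, add_comm]
    · have : ({b : F | a * b + f x = t} : Finset F) = {(t - f x) / a} := by
        ext b
        simp only [mem_filter, mem_univ, true_and, mem_singleton, eq_div_iff ha]
        constructor <;> intro h <;> linear_combination h
      simp [ha, this]
  have hsum : #{p : F × F × V | p.1 * p.2.1 + f p.2.2 = t} =
      ∑ a, ∑ x, #{b : F | a * b + f x = t} := by
    simp only [card_filter, Fintype.sum_prod_type]
    exact sum_congr rfl fun a _ => sum_comm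
  have h := sum_congr (rfl : (univ : Finset F) = univ) fun a _ =>
    sum_congr (rfl : (univ : Finset V) = univ) fun x _ => hab a x
  simp only [sum_add_distrib, ← hsum] at h
  rw [sum_comm (f := fun a (_ : V) => if a = 0 then 1 else 0),
    sum_comm (f := fun a x => if a = 0 then (if f x = t then Fintype.card F else 0) else 0)] at h
  simp only [sum_ite_eq', mem_univ, if_true, sum_const, card_univ, smul_eq_mul, mul_one,
    ← sum_filter] at h
  rw [h, mul_comm #{x | f x = t}]

lemma card_oddForm_eq (c : F) (m : ℕ) (t : F) :
    #{x | oddForm c m x = t} + Fintype.card F ^ m =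
      Fintype.card F ^ (2 * m) + Fintype.card F ^ m * #{y : F | -(c * y ^ 2) = t} := by
  induction m with
  | zero =>
    have : #{x | oddForm c 0 x = t} = #{y : F | -(c * y ^ 2) = t} := by
      refine card_equiv (Equiv.funUnique (Fin 1) F) fun x => ?_
      simp only [mem_filter, mem_univ, true_and, Equiv.funUnique_apply]
      simp [oddForm, pairsForm]
    simp [this, add_comm]
  | succ m ih =>
    have heq : #{x | oddForm c (m + 1) x = t} =
        #{p : F × F × (Fin (2 * m + 1) → F) | p.1 * p.2.1 + oddForm c m p.2.2 = t} := by
      symm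
      refine card_equiv (((Equiv.refl F).prodCongr (Fin.consEquiv fun _ => F)).trans
        (Fin.consEquiv fun _ => F)) fun p => ?_
      have := oddForm_cons_cons c m p.1 p.2.1 p.2.2
      simp only [mem_filter, mem_univ, true_and, ← this]
      rfl
    have h := card_mul_add_eq (oddForm c m) t
    rw [← heq, Fintype.card_fun, Fintype.card_fin] at h
    have h' := congrArg (Fintype.card F * ·) ih
    simp only [mul_add] at h'
    have e1 : Fintype.card F ^ (2 * m + 1) = Fintype.card F * Fintype.card F ^ (2 * m) := by ring
    have e2 : Fintype.card F ^ (2 * (m + 1)) =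
      Fintype.card F * (Fintype.card F * Fintype.card F ^ (2 * m)) := by ring
    rw [e1] at h
    rw [e2, pow_succ' _ m, mul_assoc]
    linarith

end HyperbolicForm

/-- Incidence bound for `Q_i^d`-spheres (`i ∈ {3,4}`, odd `d`) with radii in a
set `R` of non-zero elements satisfying `(−1)^{i+1}·η(−r) = −1`. -/
theorem stmt6 {F : Type*} [Field F] [Fintype F] [DecidableEq F]
    (hq : Odd (Fintype.card F)) {d : ℕ} (hd : 3 ≤ d) (hdodd : Odd d)
    (i : ℕ) (hi : i = 3 ∨ i = 4) (a : F) (ha : ¬ IsSquare a)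
    (R : Finset F)
    (hR : ∀ r ∈ R, r ≠ 0 ∧ (-1 : ℤ) ^ (i+1) * quadraticChar F (-r) = -1)
    (P : Finset (Fin d → F)) (S : Finset ((Fin d → F) × F))
    (hS : ∀ s ∈ S, s.2 ∈ R) :
    |(sphIncid (Qi a i) P S : ℝ) - (Fintype.card F : ℝ)⁻¹ * P.card * S.card|
      ≤ (Fintype.card F : ℝ) ^ ((d-1)/2) * Real.sqrt P.card * Real.sqrt S.card
        + Real.sqrt 3 * (Fintype.card F : ℝ) ^ (((d : ℝ) - 3)/4)
          * Real.sqrt P.card * S.card := by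
  obtain ⟨m, rfl⟩ := hdodd
  have h2 : (2 : F) ≠ 0 := by
    refine Ring.two_ne_zero fun h => ?_
    have := FiniteField.even_card_of_char_two h
    rw [Nat.odd_iff] at hq
    omega
  have ha0 : a ≠ 0 := by
    rintro rfl
    exact ha IsSquare.zero
  obtain ⟨c, hc, hform, hrad⟩ : ∃ c : F, c ≠ 0 ∧ (Qi a i : (Fin (2 * m + 1) → F) → F) =
      oddForm c m ∧ ∀ r ∈ R, ∀ y, -(c * y ^ 2) ≠ r := by
    have hm : (2 * m + 1 - 1) / 2 = m := by omega
    rcases hi with rfl | rfl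
    · refine ⟨1, one_ne_zero, ?_, ?_⟩
      · funext x
        simp only [Qi, Q3form, oddForm, hm]
        simp [Fin.last]
      · rintro r hr y rfl
        have h := (hR _ hr).2
        rw [neg_neg, one_mul, show (-1 : ℤ) ^ (3 + 1) = 1 by norm_num, one_mul,
          quadraticChar_neg_one_iff_not_isSquare] at h
        exact h (IsSquare.sq y)
    · refine ⟨a, ha0, ?_, ?_⟩
      · funext x
        simp only [Qi, Q4form, oddForm, hm]
        simp [Fin.last]
      · rintro r hr y rfl
        obtain ⟨h0, h⟩ := hR _ hr
        have hy : y ≠ 0 := by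
          rintro rfl
          simp at h0
        have hchar : quadraticChar F a = -1 := quadraticChar_neg_one_iff_not_isSquare.2 ha
        have hsq : quadraticChar F (y ^ 2) = 1 := quadraticChar_sq_one' hy
        rw [neg_neg, map_mul, hchar, hsq] at h
        norm_num at h
  have hmain := abs_incidences_sub_le (oddForm_add_smul c m) (oddPolar_ne_zero hc h2 m) (by simp)
    (card_oddForm_eq c m) hc P S fun s hs => hrad _ (hS s hs)
  have hq0 : (0 : ℝ) < Fintype.card F := by exact_mod_cast Fintype.card_pos
  have hpow : √((Fintype.card F : ℝ) ^ m * (Fintype.card F : ℝ)⁻¹) =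
      (Fintype.card F : ℝ) ^ (((2 * m + 1 : ℕ) - 3 : ℝ) / 4) := by
    rw [Real.sqrt_eq_rpow, ← Real.rpow_natCast, ← Real.rpow_neg_one, ← Real.rpow_add hq0,
      ← Real.rpow_mul hq0.le]
    congr 1
    push_cast
    ring
  rw [sphIncid, hform, ← hpow, show (2 * m + 1 - 1) / 2 = m by omega]
  exact hmain
end

section
/- Let d ≥ 3 be odd, let q be an odd prime power, let i ∈ {3,4}, let P ⊆ F_q^d be nonempty, and let S be a nonempty set of Q_i^d-spheres all of radius zero. Then |I(P,S) − q^{−1}|P||S|| < √((1+√2)·q^{d−1}|P||S|). -/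
open Finset

section CharacterSums

variable {F : Type*} [Field F] {χ : MulChar F ℂ} {ψ : AddChar F ℂ}

lemma MulChar.IsQuadratic.mul_self_apply (hχ : χ.IsQuadratic) {s : F} (hs : s ≠ 0) :
    χ s * χ s = 1 := by
  have h := congrArg (fun φ : MulChar F ℂ => φ s) hχ.sq_eq_one
  simpa [sq, MulChar.one_apply hs.isUnit] using h

lemma MulChar.IsQuadratic.norm_apply_le_one (hχ : χ.IsQuadratic) (s : F) : ‖χ s‖ ≤ 1 := by
  rcases hχ s with h | h | h <;> simp [h]

variable [Fintype F]

lemma MulChar.IsQuadratic.sum_mul_addChar (hχ : χ.IsQuadratic) (hχ1 : χ ≠ 1) (w : F) :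
    ∑ s, χ s * ψ (s * w) = χ w * gaussSum χ ψ := by
  by_cases hw : w = 0
  · simp [hw, MulChar.sum_eq_zero_of_ne_one hχ1]
  · have h := gaussSum_mulShift χ ψ (Units.mk0 w hw)
    rw [← h, ← mul_assoc, Units.val_mk0, hχ.mul_self_apply hw, one_mul]
    simp [gaussSum, AddChar.mulShift_apply, mul_comm]

lemma MulChar.IsQuadratic.norm_gaussSum_sq (hχ : χ.IsQuadratic) (hχ1 : χ ≠ 1)
    (hψ : ψ.IsPrimitive) : ‖gaussSum χ ψ‖ ^ 2 = Fintype.card F := by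
  have h1 : ‖χ (-1)‖ = 1 := by
    have h := congrArg norm (hχ.mul_self_apply (neg_ne_zero.mpr (one_ne_zero (α := F))))
    rw [norm_mul, norm_one] at h
    nlinarith [norm_nonneg (χ (-1))]
  rw [← norm_pow, gaussSum_sq hχ1 hχ hψ, norm_mul, h1]
  simp

lemma MulChar.IsQuadratic.norm_sum_mul_addChar_le (hχ : χ.IsQuadratic) (hχ1 : χ ≠ 1)
    (hψ : ψ.IsPrimitive) (w : F) :
    ‖∑ s, χ s * ψ (s * w)‖ ≤ Real.sqrt (Fintype.card F) := by
  rw [hχ.sum_mul_addChar hχ1, norm_mul, ← hχ.norm_gaussSum_sq hχ1 hψ,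
    Real.sqrt_sq (norm_nonneg _)]
  exact mul_le_of_le_one_left (norm_nonneg _) (hχ.norm_apply_le_one w)

lemma sum_addChar_mul_sq [DecidableEq F] (hF : ringChar F ≠ 2) (hψ : ψ.IsPrimitive) {u : F}
    (hu : u ≠ 0) :
    ∑ y, ψ (u * y ^ 2) = (quadraticChar F).ringHomComp (Int.castRingHom ℂ) u *
      gaussSum ((quadraticChar F).ringHomComp (Int.castRingHom ℂ)) ψ := by
  have hχ := (quadraticChar_isQuadratic F).comp (Int.castRingHom ℂ)
  have hχ1 := (MulChar.ringHomComp_ne_one_iff (f := Int.castRingHom ℂ)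
    Int.cast_injective).mpr (quadraticChar_ne_one hF)
  rw [← hχ.sum_mul_addChar hχ1]
  have hfib : ∑ y, ψ (u * y ^ 2) = ∑ t, ((quadraticChar F t + 1 : ℤ) : ℂ) * ψ (t * u) := by
    rw [← Finset.sum_fiberwise Finset.univ (fun y : F => y ^ 2)]
    refine Finset.sum_congr rfl fun t _ => ?_
    rw [← quadraticChar_card_sqrts hF, Finset.sum_congr rfl
      (g := fun _ => ψ (t * u)) (fun y hy => by
        rw [(Finset.mem_filter.mp hy).2, mul_comm]), Finset.sum_const, nsmul_eq_mul]
    rw [Int.cast_natCast]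
    congr 3
    ext; simp
  rw [hfib]
  simp only [Int.cast_add, Int.cast_one, add_mul, one_mul, Finset.sum_add_distrib]
  rw [AddChar.sum_mulShift u hψ]
  simp [hu]

end CharacterSums

section NondegenerateForms

variable {F V : Type*} [Field F] [AddCommGroup V] [Module F V] [Fintype V]
  {Q : QuadraticForm F V} {χ : MulChar F ℂ} {ψ : AddChar F ℂ}

open QuadraticMap

lemma sum_addChar_polar [DecidableEq V] (hQ : Q.polarBilin.SeparatingRight)
    (hψ : ψ.IsPrimitive) (z : V) :
    ∑ y, ψ (polar Q y z) = if z = 0 then (Fintype.card V : ℂ) else 0 := by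
  split_ifs with hz
  · simp [hz]
  · have hne : ∃ y, polar Q y z ≠ 0 := by
      by_contra! h
      exact hz (hQ z h)
    obtain ⟨y, hy⟩ := hne
    let φ : AddChar V ℂ := ψ.compAddMonoidHom (Q.polarBilin.flip z).toAddMonoidHom
    have hφ : φ ≠ 1 := by
      intro h
      apply hψ hy
      ext t
      have := congrArg (fun f : AddChar V ℂ => f (t • y)) h
      simpa [φ, AddChar.mulShift_apply, mul_comm] using this
    exact AddChar.sum_eq_zero_of_ne_one hφ

lemma sum_addChar_form_mul_polar {s : F} (hs : s ≠ 0) (z : V) :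
    ∑ y, ψ (s * Q y) * ψ (polar Q y z) = (∑ y, ψ (s * Q y)) * ψ (-(s⁻¹ * Q z)) := by
  rw [← Equiv.sum_comp (Equiv.addRight (s⁻¹ • z)) (fun y => ψ (s * Q y)), Finset.sum_mul]
  refine Finset.sum_congr rfl fun y _ => ?_
  rw [← AddChar.map_add_eq_mul, ← AddChar.map_add_eq_mul, Equiv.coe_addRight,
    QuadraticMap.map_add Q, Q.polar_smul_right, Q.map_smul]
  congr 1
  simp only [smul_eq_mul]
  field_simp
  ring

variable [Fintype F]

/-- Parseval identity for the Fourier transform attached to the polar form of `Q`. -/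
lemma sum_norm_sq_sum_addChar_polar (hQ : Q.polarBilin.SeparatingRight)
    (hψ : ψ.IsPrimitive) (P : Finset V) :
    ∑ y, ‖∑ x ∈ P, ψ (polar Q y x)‖ ^ 2 = Fintype.card V * P.card := by
  classical
  have h : ∑ y, ((‖∑ x ∈ P, ψ (polar Q y x)‖ ^ 2 : ℝ) : ℂ)
      = ∑ x ∈ P, ∑ x' ∈ P, ∑ y, ψ (polar Q y (x - x')) := by
    simp_rw [Finset.sum_comm (s := P) (t := (Finset.univ : Finset V))]
    refine Finset.sum_congr rfl fun y _ => ?_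
    rw [Complex.ofReal_pow, ← Complex.mul_conj', map_sum, Finset.sum_mul_sum]
    refine Finset.sum_congr rfl fun x _ => Finset.sum_congr rfl fun x' _ => ?_
    rw [← AddChar.map_neg_eq_conj, ← AddChar.map_add_eq_mul, polar_sub_right, sub_eq_add_neg]
  simp_rw [sum_addChar_polar hQ hψ, sub_eq_zero] at h
  rw [← Complex.ofReal_inj, Complex.ofReal_sum, h]
  simp [mul_comm]

lemma norm_sq_sum_addChar_form (hQ : Q.polarBilin.SeparatingRight) (hψ : ψ.IsPrimitive) :
    ‖∑ x, ψ (Q x)‖ ^ 2 = Fintype.card V := by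
  classical
  rw [← Complex.ofReal_inj, Complex.ofReal_pow, ← Complex.mul_conj', map_sum,
    Finset.sum_mul_sum, Finset.sum_comm]
  have h (x : V) : ∑ z, ψ (Q z) * (starRingEnd ℂ) (ψ (Q x))
      = ∑ z, ψ (Q z) * ψ (polar Q x z) := by
    rw [← Equiv.sum_comp (Equiv.addLeft x)]
    refine Finset.sum_congr rfl fun z _ => ?_
    rw [← AddChar.map_neg_eq_conj, ← AddChar.map_add_eq_mul, ← AddChar.map_add_eq_mul,
      Equiv.coe_addLeft, QuadraticMap.map_add Q]
    congr 1
    ring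
  simp_rw [h]
  rw [Finset.sum_comm]
  simp_rw [← Finset.mul_sum, sum_addChar_polar hQ hψ]
  simp

/-- The Fourier expansion of `∑_{t ≠ 0} ψ (t * Q z)`, for forms whose Gauss sums vary
like a quadratic character. -/
lemma sum_addChar_form_expansion [DecidableEq F] (hχ : χ.IsQuadratic)
    (hG : ∀ s : F, s ≠ 0 → ∑ x, ψ (s * Q x) = χ s * ∑ x, ψ (Q x)) (z : V) :
    (∑ x, ψ (Q x)) * ∑ t ∈ Finset.univ.erase (0 : F), ψ (t * Q z)
      = ∑ y, (∑ s, χ s * ψ (s * Q y)) * ψ (polar Q y z) := by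
  have h1 : ∑ t ∈ Finset.univ.erase (0 : F), ψ (t * Q z)
      = ∑ s ∈ Finset.univ.erase (0 : F), ψ (-(s⁻¹ * Q z)) := by
    refine Finset.sum_nbij' (fun t => -t⁻¹) (fun t => -t⁻¹) ?_ ?_ ?_ ?_ ?_ <;>
      simp [inv_neg]
  have h2 : ∑ y, (∑ s, χ s * ψ (s * Q y)) * ψ (polar Q y z)
      = ∑ s, χ s * ∑ y, ψ (s * Q y) * ψ (polar Q y z) := by
    simp_rw [Finset.sum_mul, Finset.mul_sum, mul_assoc]
    exact Finset.sum_comm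
  rw [h1, h2, ← Finset.add_sum_erase _ _ (Finset.mem_univ (0 : F)), MulChar.map_zero, zero_mul,
    zero_add, Finset.mul_sum]
  refine Finset.sum_congr rfl fun s hs => ?_
  have hs := Finset.ne_of_mem_erase hs
  rw [sum_addChar_form_mul_polar hs, hG s hs, ← mul_assoc, ← mul_assoc, hχ.mul_self_apply hs,
    one_mul]

lemma norm_sum_sum_addChar_form_le [DecidableEq F] (hQ : Q.polarBilin.SeparatingRight)
    (hψ : ψ.IsPrimitive) (hχ : χ.IsQuadratic) (hχ1 : χ ≠ 1)
    (hG : ∀ s : F, s ≠ 0 → ∑ x, ψ (s * Q x) = χ s * ∑ x, ψ (Q x)) (P C : Finset V) :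
    ‖∑ x ∈ P, ∑ c ∈ C, ∑ t ∈ Finset.univ.erase (0 : F), ψ (t * Q (x - c))‖ ^ 2
      ≤ Fintype.card F * Fintype.card V * P.card * C.card := by
  have hV : (0 : ℝ) < Fintype.card V := by exact_mod_cast Fintype.card_pos
  set E := ∑ x ∈ P, ∑ c ∈ C, ∑ t ∈ Finset.univ.erase (0 : F), ψ (t * Q (x - c)) with hE
  have hexp : (∑ x, ψ (Q x)) * E = ∑ y, (∑ s, χ s * ψ (s * Q y)) *
      ((∑ x ∈ P, ψ (polar Q y x)) * (starRingEnd ℂ) (∑ c ∈ C, ψ (polar Q y c))) := by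
    rw [hE, Finset.mul_sum P]
    simp_rw [Finset.mul_sum C, sum_addChar_form_expansion hχ hG,
      Finset.sum_comm (s := C) (t := (Finset.univ : Finset V))]
    rw [Finset.sum_comm (s := P) (t := (Finset.univ : Finset V))]
    refine Finset.sum_congr rfl fun y _ => ?_
    rw [map_sum, Finset.sum_mul_sum, Finset.mul_sum P]
    refine Finset.sum_congr rfl fun x _ => ?_
    rw [Finset.mul_sum C]
    refine Finset.sum_congr rfl fun c _ => ?_
    rw [← AddChar.map_neg_eq_conj, ← AddChar.map_add_eq_mul, polar_sub_right, sub_eq_add_neg]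
  have hle : ‖∑ x, ψ (Q x)‖ * ‖E‖ ≤ Real.sqrt (Fintype.card F) *
      ∑ y, ‖∑ x ∈ P, ψ (polar Q y x)‖ * ‖∑ c ∈ C, ψ (polar Q y c)‖ := by
    rw [← norm_mul, hexp, Finset.mul_sum]
    refine (norm_sum_le _ _).trans (Finset.sum_le_sum fun y _ => ?_)
    rw [norm_mul, norm_mul, RCLike.norm_conj]
    gcongr
    exact hχ.norm_sum_mul_addChar_le hχ1 hψ _
  have hcs := Finset.sum_mul_sq_le_sq_mul_sq Finset.univ
    (fun y => ‖∑ x ∈ P, ψ (polar Q y x)‖) (fun y => ‖∑ c ∈ C, ψ (polar Q y c)‖)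
  rw [sum_norm_sq_sum_addChar_polar hQ hψ, sum_norm_sq_sum_addChar_polar hQ hψ] at hcs
  have hsq := pow_le_pow_left₀ (by positivity) hle 2
  rw [mul_pow, mul_pow, norm_sq_sum_addChar_form hQ hψ, Real.sq_sqrt (by positivity)] at hsq
  have := hsq.trans (mul_le_mul_of_nonneg_left hcs (Nat.cast_nonneg _))
  refine le_of_mul_le_mul_left ?_ hV
  linarith

/-- The number of pairs in `P × C` whose difference is isotropic, compared with its
expected value. -/
theorem sq_card_isotropic_sub_le [DecidableEq F] (hQ : Q.polarBilin.SeparatingRight)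
    (hψ : ψ.IsPrimitive) (hχ : χ.IsQuadratic) (hχ1 : χ ≠ 1)
    (hG : ∀ s : F, s ≠ 0 → ∑ x, ψ (s * Q x) = χ s * ∑ x, ψ (Q x)) (P C : Finset V) :
    Fintype.card F * ((((P ×ˢ C).filter fun z => Q (z.1 - z.2) = 0).card : ℝ)
        - (Fintype.card F : ℝ)⁻¹ * P.card * C.card) ^ 2
      ≤ Fintype.card V * P.card * C.card := by
  have hq : (0 : ℝ) < Fintype.card F := by exact_mod_cast Fintype.card_pos
  have hsum : ∑ x ∈ P, ∑ c ∈ C, ∑ t ∈ Finset.univ.erase (0 : F), ψ (t * Q (x - c))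
      = ((Fintype.card F * (((P ×ˢ C).filter fun z => Q (z.1 - z.2) = 0).card : ℝ)
        - P.card * C.card : ℝ) : ℂ) := by
    have hz (w : F) : ∑ t ∈ Finset.univ.erase (0 : F), ψ (t * w)
        = (Fintype.card F : ℂ) * (if w = 0 then 1 else 0) - 1 := by
      have h := Finset.sum_erase_add _ (fun t => ψ (t * w)) (Finset.mem_univ (0 : F))
      rw [AddChar.sum_mulShift w hψ, zero_mul, AddChar.map_zero_eq_one] at h
      rw [eq_sub_iff_add_eq, h]
      split_ifs <;> simp
    simp_rw [hz, ← Finset.sum_product', Finset.sum_sub_distrib, ← Finset.mul_sum,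
      Finset.sum_boole]
    simp
  have h := norm_sum_sum_addChar_form_le hQ hψ hχ hχ1 hG P C
  rw [hsum, Complex.norm_real, Real.norm_eq_abs, sq_abs] at h
  refine le_of_mul_le_mul_left ?_ hq
  refine Eq.trans_le ?_ (h.trans_eq (by ring))
  field_simp

end NondegenerateForms

section OddDimensionalForm

variable {F : Type*} [Field F]

/-- `x₀x₁ + ⋯ + x_{2k-2}x_{2k-1} - b x_{2k}²` as a quadratic form. -/
def hyperbolicSubSq (b : F) (k : ℕ) : QuadraticForm F (Fin (2 * k + 1) → F) :=
  ∑ j : Fin k, QuadraticMap.linMulLin (LinearMap.proj ⟨2 * j, by omega⟩)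
      (LinearMap.proj ⟨2 * j + 1, by omega⟩)
    - b • QuadraticMap.linMulLin (LinearMap.proj (Fin.last _)) (LinearMap.proj (Fin.last _))

lemma hyperbolicSubSq_apply (b : F) (k : ℕ) (x : Fin (2 * k + 1) → F) :
    hyperbolicSubSq b k x = ∑ j : Fin k, x ⟨2 * j, by omega⟩ * x ⟨2 * j + 1, by omega⟩
      - b * x (Fin.last _) ^ 2 := by
  simp [hyperbolicSubSq, sq]

lemma polar_hyperbolicSubSq (b : F) (k : ℕ) (x y : Fin (2 * k + 1) → F) :
    QuadraticMap.polar (hyperbolicSubSq b k) x y =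
      ∑ j : Fin k, (x ⟨2 * j, by omega⟩ * y ⟨2 * j + 1, by omega⟩
        + x ⟨2 * j + 1, by omega⟩ * y ⟨2 * j, by omega⟩)
      - 2 * b * (x (Fin.last _) * y (Fin.last _)) := by
  have h : ∑ j : Fin k, (x ⟨2 * j, by omega⟩ * y ⟨2 * j + 1, by omega⟩
        + x ⟨2 * j + 1, by omega⟩ * y ⟨2 * j, by omega⟩)
      = ∑ j : Fin k, (x + y) ⟨2 * j, by omega⟩ * (x + y) ⟨2 * j + 1, by omega⟩
        - ∑ j : Fin k, x ⟨2 * j, by omega⟩ * x ⟨2 * j + 1, by omega⟩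
        - ∑ j : Fin k, y ⟨2 * j, by omega⟩ * y ⟨2 * j + 1, by omega⟩ := by
    rw [← Finset.sum_sub_distrib, ← Finset.sum_sub_distrib]
    refine Finset.sum_congr rfl fun j _ => ?_
    simp only [Pi.add_apply]
    ring
  rw [h, QuadraticMap.polar]
  simp only [hyperbolicSubSq_apply, Pi.add_apply]
  ring

lemma separatingRight_polar_hyperbolicSubSq (h2 : (2 : F) ≠ 0) {b : F} (hb : b ≠ 0) (k : ℕ) :
    (hyperbolicSubSq b k).polarBilin.SeparatingRight := by
  intro y hy
  have key (i : Fin (2 * k + 1)) :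
      QuadraticMap.polar (hyperbolicSubSq b k) (Pi.single i 1) y = 0 := hy _
  simp only [polar_hyperbolicSubSq, Pi.single_apply] at key
  funext i
  rcases eq_or_ne i (Fin.last _) with rfl | hi
  · have hl := key (Fin.last _)
    rw [Finset.sum_eq_zero] at hl
    · simpa [h2, hb] using hl
    · intro j _
      have h₀ : (⟨2 * j, by omega⟩ : Fin (2 * k + 1)) ≠ Fin.last _ := by
        simp only [ne_eq, Fin.ext_iff, Fin.val_last]; omega
      have h₁ : (⟨2 * j + 1, by omega⟩ : Fin (2 * k + 1)) ≠ Fin.last _ := by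
        simp only [ne_eq, Fin.ext_iff, Fin.val_last]; omega
      simp [h₀, h₁]
  · have hlt : (i : ℕ) < 2 * k := by
      have : (i : ℕ) ≠ 2 * k := fun h => hi (Fin.ext h)
      omega
    rcases Nat.even_or_odd' (i : ℕ) with ⟨m, hm | hm⟩
    · have hp := key ⟨2 * m + 1, by omega⟩
      rw [Finset.sum_eq_single (⟨m, by omega⟩ : Fin k)] at hp
      · have : i = ⟨2 * m, by omega⟩ := Fin.ext hm
        rw [if_neg (by simp only [Fin.ext_iff]; omega), if_pos rfl,
          if_neg (by simp only [Fin.ext_iff, Fin.val_last]; omega)] at hp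
        simpa [this] using hp
      · intro j _ hj
        have hj' : (j : ℕ) ≠ m := fun h => hj (Fin.ext h)
        rw [if_neg (by simp only [Fin.ext_iff]; omega),
          if_neg (by simp only [Fin.ext_iff]; omega)]
        simp
      · simp
    · have hp := key ⟨2 * m, by omega⟩
      rw [Finset.sum_eq_single (⟨m, by omega⟩ : Fin k)] at hp
      · have : i = ⟨2 * m + 1, by omega⟩ := Fin.ext hm
        rw [if_pos rfl, if_neg (by simp only [Fin.ext_iff]; omega),
          if_neg (by simp only [Fin.ext_iff, Fin.val_last]; omega)] at hp
        simpa [this] using hp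
      · intro j _ hj
        have hj' : (j : ℕ) ≠ m := fun h => hj (Fin.ext h)
        rw [if_neg (by simp only [Fin.ext_iff]; omega),
          if_neg (by simp only [Fin.ext_iff]; omega)]
        simp
      · simp

lemma Qi_eq_hyperbolicSubSq (a : F) {i : ℕ} (hi : i = 3 ∨ i = 4) (k : ℕ)
    (x : Fin (2 * k + 1) → F) :
    Qi a i x = hyperbolicSubSq (if i = 3 then 1 else a) k x := by
  have hp : pairsForm k x = ∑ j : Fin k, x ⟨2 * j, by omega⟩ * x ⟨2 * j + 1, by omega⟩ := by
    rw [pairsForm, Finset.sum_range]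
    refine Finset.sum_congr rfl fun j _ => ?_
    rw [dif_pos (by omega)]
  rw [hyperbolicSubSq_apply, ← hp]
  rcases hi with rfl | rfl <;> simp [Qi, Q3form, Q4form, Fin.last]

variable [Fintype F] {ψ : AddChar F ℂ}

lemma sum_addChar_hyperbolic (k : ℕ) {s : F} (hs : s ≠ 0) :
    ∑ x : Fin (2 * k) → F, ψ (s * ∑ j : Fin k, x ⟨2 * j, by omega⟩ * x ⟨2 * j + 1, by omega⟩)
      = ∑ x : Fin (2 * k) → F,
          ψ (∑ j : Fin k, x ⟨2 * j, by omega⟩ * x ⟨2 * j + 1, by omega⟩) := by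
  let e : (Fin (2 * k) → F) ≃ (Fin (2 * k) → F) := Equiv.piCongrRight fun i =>
    if Even (i : ℕ) then Equiv.mulLeft₀ s hs else Equiv.refl F
  rw [← Equiv.sum_comp e (fun x : Fin (2 * k) → F =>
    ψ (∑ j : Fin k, x ⟨2 * j, by omega⟩ * x ⟨2 * j + 1, by omega⟩))]
  refine Finset.sum_congr rfl fun x _ => ?_
  simp [e, Finset.mul_sum, mul_assoc]

variable [DecidableEq F]

lemma sum_addChar_mul_hyperbolicSubSq (hF : ringChar F ≠ 2) (hψ : ψ.IsPrimitive) {b : F}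
    (hb : b ≠ 0) (k : ℕ) {s : F} (hs : s ≠ 0) :
    ∑ x, ψ (s * hyperbolicSubSq b k x) =
      (∑ x : Fin (2 * k) → F,
        ψ (∑ j : Fin k, x ⟨2 * j, by omega⟩ * x ⟨2 * j + 1, by omega⟩)) *
      ((quadraticChar F).ringHomComp (Int.castRingHom ℂ) (s * -b) *
        gaussSum ((quadraticChar F).ringHomComp (Int.castRingHom ℂ)) ψ) := by
  rw [← sum_addChar_mul_sq hF hψ (mul_ne_zero hs (neg_ne_zero.mpr hb)),
    ← sum_addChar_hyperbolic k hs, Finset.sum_mul_sum, Finset.sum_comm, ← Fintype.sum_prod_type',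
    ← Equiv.sum_comp (Fin.snocEquiv fun _ => F)]
  refine Finset.sum_congr rfl fun p _ => ?_
  rw [← AddChar.map_add_eq_mul, hyperbolicSubSq_apply]
  have hinit (j : ℕ) (hj : j < 2 * k) :
      (Fin.snocEquiv fun _ => F) p ⟨j, by omega⟩ = p.2 ⟨j, hj⟩ :=
    Fin.snoc_castSucc (α := fun _ => F) p.1 p.2 ⟨j, hj⟩
  have hlast : (Fin.snocEquiv fun _ => F) p (Fin.last _) = p.1 :=
    Fin.snoc_last (α := fun _ => F) p.1 p.2
  rw [hlast, Finset.sum_congr rfl fun j _ => by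
    rw [hinit (2 * j) (by omega), hinit (2 * j + 1) (by omega)]]
  congr 1
  ring

end OddDimensionalForm

/-- Incidence bound for zero-radius `Q_i^d`-spheres in odd dimension. -/
theorem stmt11 {F : Type*} [Field F] [Fintype F] [DecidableEq F]
    (hq : Odd (Fintype.card F)) {d : ℕ} (hd : 3 ≤ d) (hdodd : Odd d)
    (i : ℕ) (hi : i = 3 ∨ i = 4) (a : F) (ha : ¬ IsSquare a)
    (P : Finset (Fin d → F)) (hP : P.Nonempty)
    (S : Finset ((Fin d → F) × F)) (hSne : S.Nonempty)
    (hS : ∀ s ∈ S, s.2 = 0) :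
    |(sphIncid (Qi a i) P S : ℝ) - (Fintype.card F : ℝ)⁻¹ * P.card * S.card|
      < Real.sqrt ((1 + Real.sqrt 2) * (Fintype.card F : ℝ) ^ (d-1)
          * P.card * S.card) := by
  obtain ⟨k, rfl⟩ := hdodd
  have hF : ringChar F ≠ 2 := by
    rw [ne_eq, FiniteField.even_card_iff_char_two, Nat.odd_iff.mp hq]
    decide
  have hb : (if i = 3 then 1 else a) ≠ 0 := by
    split_ifs
    · exact one_ne_zero
    · rintro rfl
      exact ha IsSquare.zero
  have h2 : (2 : F) ≠ 0 := Ring.two_ne_zero hF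
  let e := AddChar.FiniteField.primitiveChar_to_Complex F
  have he : e.IsPrimitive :=
    AddChar.FiniteField.primitiveChar_to_Complex_isPrimitive F
  have hχ := (quadraticChar_isQuadratic F).comp (Int.castRingHom ℂ)
  have hχ1 := (MulChar.ringHomComp_ne_one_iff (f := Int.castRingHom ℂ)
    Int.cast_injective).mpr (quadraticChar_ne_one hF)
  have hinj : Set.InjOn Prod.fst (S : Set ((Fin (2 * k + 1) → F) × F)) := fun s hs t ht h =>
    Prod.ext h ((hS s hs).trans (hS t ht).symm)
  have hcard : (S.image Prod.fst).card = S.card := Finset.card_image_of_injOn hinj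
  have hinc : sphIncid (Qi a i) P S = ((P ×ˢ S.image Prod.fst).filter fun z =>
      hyperbolicSubSq (if i = 3 then 1 else a) k (z.1 - z.2) = 0).card := by
    refine Finset.card_bij (fun z _ => (z.1, z.2.1)) ?_ ?_ ?_
    · rintro ⟨x, s⟩ hz
      simp only [Finset.mem_filter, Finset.mem_product] at hz ⊢
      rw [← Qi_eq_hyperbolicSubSq a hi, hz.2]
      exact ⟨⟨hz.1.1, Finset.mem_image_of_mem _ hz.1.2⟩, hS s hz.1.2⟩
    · rintro ⟨x, s⟩ hz ⟨y, t⟩ hw h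
      simp only [Finset.mem_filter, Finset.mem_product, Prod.mk.injEq] at hz hw h
      exact Prod.ext h.1 (hinj hz.1.2 hw.1.2 h.2)
    · rintro ⟨x, c⟩ hz
      simp only [Finset.mem_filter, Finset.mem_product, Finset.mem_image] at hz
      obtain ⟨⟨hx, s, hs, rfl⟩, h0⟩ := hz
      refine ⟨(x, s), ?_, rfl⟩
      simp only [Finset.mem_filter, Finset.mem_product]
      exact ⟨⟨hx, hs⟩, by rw [Qi_eq_hyperbolicSubSq a hi, h0, hS s hs]⟩
  have hbound := sq_card_isotropic_sub_le (separatingRight_polar_hyperbolicSubSq h2 hb k)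
    he hχ hχ1 (fun s hs => by
      have h1 := sum_addChar_mul_hyperbolicSubSq hF he hb k (one_ne_zero (α := F))
      simp only [one_mul] at h1
      rw [sum_addChar_mul_hyperbolicSubSq hF he hb k hs, h1, map_mul]
      ring) P (S.image Prod.fst)
  rw [← hinc, hcard, Fintype.card_fun, Fintype.card_fin] at hbound
  have hqpos : (0 : ℝ) < Fintype.card F := by exact_mod_cast Fintype.card_pos
  have hPpos : (0 : ℝ) < P.card := by exact_mod_cast hP.card_pos
  have hSpos : (0 : ℝ) < S.card := by exact_mod_cast hSne.card_pos
  have hsq : ((sphIncid (Qi a i) P S : ℝ) - (Fintype.card F : ℝ)⁻¹ * P.card * S.card) ^ 2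
      ≤ (Fintype.card F : ℝ) ^ (2 * k) * P.card * S.card := by
    refine le_of_mul_le_mul_left (hbound.trans_eq ?_) hqpos
    push_cast
    ring
  rw [← Real.sqrt_sq_eq_abs, Nat.add_sub_cancel]
  refine Real.sqrt_lt_sqrt (sq_nonneg _) (hsq.trans_lt ?_)
  have hpos : 0 < (Fintype.card F : ℝ) ^ (2 * k) * P.card * S.card := by positivity
  have h2pos : 0 < Real.sqrt 2 := by positivity
  nlinarith [mul_pos h2pos hpos]
end
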